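/- Let a, b ∈ M \ M₁, c ∈ M₁ and k ≥ 0 be such that ab = cΔ^k and dpt(a) + dpt(b) = k + 2. Then a ∈ Θ and b ∈ Θ. -/

import Mathlib

namespace GarsideOrder

variable {G : Type*} [Group G]

/-- `a ≤_R b` iff `b * a⁻¹ ∈ M`. -/
def leR (M : Submonoid G) (a b : G) : Prop := b * a⁻¹ ∈ M

/-- `a ≤_L b` iff `a⁻¹ * b ∈ M`. -/
def leL (M : Submonoid G) (a b : G) : Prop := a⁻¹ * b ∈ M

/-- Right divisors (in `M`) of `a`. -/
def DivR (M : Submonoid G) (a : G) : Set G := {b : G | b ∈ M ∧ leR M b a}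

/-- Left divisors (in `M`) of `a`. -/
def DivL (M : Submonoid G) (a : G) : Set G := {b : G | b ∈ M ∧ leL M b a}

/-- `a` is balanced if its sets of right and left divisors coincide. -/
def Balanced (M : Submonoid G) (a : G) : Prop := DivR M a = DivL M a

open Classical in
/-- The `N`-tail of `a`: the unique `b ∈ N` having the same right divisors lying in `N`
as `a` (w.r.t. the divisibility of the ambient monoid `M`). -/
noncomputable def tail (M N : Submonoid G) (a : G) : G :=
  if h : ∃ b : G, b ∈ N ∧
      {c : G | c ∈ N ∧ leR M c a} = {c : G | c ∈ N ∧ leR M c b} then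
    h.choose
  else 1

/-- Iterated stripping of alternating tails: first the `M₁`-tail, then the `N`-tail, etc. -/
noncomputable def strip (M M₁ N : Submonoid G) : ℕ → G → G
  | 0, a => a
  | i + 1, a =>
      strip M M₁ N i a *
        (tail M (if i % 2 = 0 then M₁ else N) (strip M M₁ N i a))⁻¹

/-- The breadth of `a`: the length of the alternating form of `a`, i.e. the least `p ≥ 1`
such that stripping alternating tails `p` times reaches `1`. -/
noncomputable def bh (M M₁ N : Submonoid G) (a : G) : ℕ :=
  sInf {p : ℕ | 1 ≤ p ∧ strip M M₁ N p a = 1}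

/-- The depth of `a`: `(bh a - 1)/2` if `bh a` is odd, `bh a / 2` if `bh a` is even;
in both cases this is `bh a / 2` with natural division. -/
noncomputable def dpt (M M₁ N : Submonoid G) (a : G) : ℕ := bh M M₁ N a / 2

/-- `a ∈ M` is unmovable if `Δ` does not right-divide it. -/
def Unmovable (M : Submonoid G) (Δ a : G) : Prop := a ∈ M ∧ ¬ leR M Δ a

/-- `α` is `(H, G₁)`-negative: its `Δ`-form is `a Δ^{-k}` with `k ≥ 1` and
`dpt a < dpt (Δ^k)`. -/
def Negative (M M₁ N : Submonoid G) (Δ : G) (α : G) : Prop :=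
  ∃ a : G, ∃ k : ℕ, Unmovable M Δ a ∧ 1 ≤ k ∧ α = a * (Δ ^ k)⁻¹ ∧
    dpt M M₁ N a < dpt M M₁ N (Δ ^ k)

/-- `α` is `(H, G₁)`-positive if `α⁻¹` is `(H, G₁)`-negative. -/
def Positive (M M₁ N : Submonoid G) (Δ : G) (α : G) : Prop :=
  Negative M M₁ N Δ α⁻¹

/-- The set `Θ` of theta elements `θ^k a₀`, `k ≥ 1`, `a₀ ∈ M₁`. -/
def thetaSet (M₁ : Submonoid G) (θ : G) : Set G :=
  {x : G | ∃ k : ℕ, 1 ≤ k ∧ ∃ a₀ ∈ M₁, x = θ ^ k * a₀}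

/-- `Θ̄ = Θ ∪ M₁`. -/
def thetaBar (M₁ : Submonoid G) (θ : G) : Set G := thetaSet M₁ θ ∪ (M₁ : Set G)

/-- Condition A with constant `ζ`: `dpt (Δ^k) = ζ k + 1` for all `k ≥ 1`. -/
def CondA (M M₁ N : Submonoid G) (Δ : G) (ζ : ℕ) : Prop :=
  ∀ k : ℕ, 1 ≤ k → dpt M M₁ N (Δ ^ k) = ζ * k + 1

/-- Condition B with constant `ζ`. -/
def CondB (M M₁ N : Submonoid G) (Δ θ : G) (ζ : ℕ) : Prop :=
  ∀ a b c : G, ∀ t : ℤ,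
    Unmovable M Δ a → Unmovable M Δ b →
    ¬(a ∈ thetaBar M₁ θ ∧ b ∈ thetaBar M₁ θ) →
    Unmovable M Δ c → a * b = c * Δ ^ t →
    ∃ ε : ℕ, ε ≤ 1 ∧
      (dpt M M₁ N c : ℤ) =
        (dpt M M₁ N a : ℤ) + (dpt M M₁ N b : ℤ) - (ζ : ℤ) * t - (ε : ℤ) ∧
      ((a ∈ thetaSet M₁ θ ∨ b ∈ thetaSet M₁ θ ∨ c ∈ M₁) → ε = 1)

/-- A Garside structure with group of fractions the subgroup `car`. -/
structure IsGarsideOn (car : Subgroup G) (M : Submonoid G) (Δ : G) : Prop where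
  M_sub : (M : Set G) ⊆ (car : Set G)
  delta_mem : Δ ∈ M
  units_trivial : ∀ x : G, x ∈ M → x⁻¹ ∈ M → x = 1
  noetherian : ∀ a ∈ M, ∃ n : ℕ, 1 ≤ n ∧ ∀ l : List G,
      (∀ x ∈ l, x ∈ M ∧ x ≠ 1) → l.prod = a → l.length ≤ n
  balanced : Balanced M Δ
  div_finite : (DivR M Δ).Finite
  div_gen_monoid : Submonoid.closure (DivR M Δ) = M
  div_gen_group : Subgroup.closure (DivR M Δ) = car
  meet : ∀ a ∈ car, ∀ b ∈ car, ∃ c ∈ car, leR M c a ∧ leR M c b ∧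
      ∀ d ∈ car, leR M d a → leR M d b → leR M d c
  join : ∀ a ∈ car, ∀ b ∈ car, ∃ c ∈ car, leR M a c ∧ leR M b c ∧
      ∀ d ∈ car, leR M a d → leR M b d → leR M c d

/-- The parabolic submonoid determined by `δ`: the submonoid generated by `Div(δ)`. -/
def parM (M : Submonoid G) (δ : G) : Submonoid G := Submonoid.closure (DivR M δ)

/-- The parabolic subgroup determined by `δ`: the subgroup generated by `Div(δ)`. -/
def parG (M : Submonoid G) (δ : G) : Subgroup G := Subgroup.closure (DivR M δ)

/-- `δ` determines a parabolic substructure of `(G, M, Δ)`. -/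
structure IsParabolic (M : Submonoid G) (Δ δ : G) : Prop where
  mem : δ ∈ M
  balanced : Balanced M δ
  div_eq : DivR M δ = DivR M Δ ∩ (parM M δ : Set G)

/-- The setting of Section 3: a Garside structure `(car, M, Δ)` together with two
parabolic substructures `(H, N, Λ)` (given by `lam`) and `(G₁, M₁, Δ₁)` (given by `δ1`),
with `N ≠ M`, `M₁ ≠ M`, `N ∪ M₁` generating `M`, `Δ` central, `Δ₁` central in `G₁`. -/
structure Setting (G : Type*) [Group G] where
  car : Subgroup G
  M : Submonoid G
  Δ : G
  δ1 : G
  lam : G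
  garside : IsGarsideOn car M Δ
  par1 : IsParabolic M Δ δ1
  parH : IsParabolic M Δ lam
  N_ne : parM M lam ≠ M
  M1_ne : parM M δ1 ≠ M
  unionGen : Submonoid.closure ((parM M lam : Set G) ∪ (parM M δ1 : Set G)) = M
  delta_central : ∀ g ∈ car, Δ * g = g * Δ
  delta1_central : ∀ g ∈ parG M δ1, δ1 * g = g * δ1

namespace Setting

variable (S : Setting G)

/-- The parabolic submonoid `M₁`. -/
def M₁ : Submonoid G := parM S.M S.δ1

/-- The parabolic submonoid `N`. -/
def Nsub : Submonoid G := parM S.M S.lam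

/-- The parabolic subgroup `G₁`. -/
def G₁ : Subgroup G := parG S.M S.δ1

/-- `θ = Δ Δ₁⁻¹`. -/
def theta : G := S.Δ * S.δ1⁻¹

/-- The set of `(H, G₁)`-negative elements. -/
def Neg : Set G := {α : G | Negative S.M S.M₁ S.Nsub S.Δ α}

/-- The set of `(H, G₁)`-positive elements. -/
def Pos : Set G := {α : G | α⁻¹ ∈ S.Neg}

/-- Condition A. -/
def condA (ζ : ℕ) : Prop := CondA S.M S.M₁ S.Nsub S.Δ ζ

/-- Condition B. -/
def condB (ζ : ℕ) : Prop := CondB S.M S.M₁ S.Nsub S.Δ S.theta ζ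

/-- `(H, G₁)` is a Dehornoy structure: `PP ⊆ P`, `G₁ P G₁ ⊆ P`, and the group is the
disjoint union of `P`, `P⁻¹` and `G₁`. -/
def IsDehornoy : Prop :=
  (∀ α ∈ S.Pos, ∀ β ∈ S.Pos, α * β ∈ S.Pos) ∧
  (∀ g₁ ∈ S.G₁, ∀ α ∈ S.Pos, ∀ g₂ ∈ S.G₁, g₁ * α * g₂ ∈ S.Pos) ∧
  (∀ α ∈ S.car, α ∈ S.Pos ∨ α ∈ S.Neg ∨ α ∈ S.G₁) ∧
  (∀ α : G, ¬(α ∈ S.Pos ∧ α ∈ S.Neg)) ∧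
  (∀ α : G, ¬(α ∈ S.Pos ∧ α ∈ S.G₁)) ∧
  (∀ α : G, ¬(α ∈ S.Neg ∧ α ∈ S.G₁))

end Setting

end GarsideOrder


namespace BraidOrder

open GarsideOrder

/-- The braid relations on `n` generators `σ_0, …, σ_{n-1}` (representing `s_1, …, s_n`). -/
def braidRel (n : ℕ) : Set (FreeGroup (Fin n)) :=
  {r | ∃ i j : Fin n,
      ((i : ℕ) + 1 = (j : ℕ) ∧
        r = FreeGroup.of i * FreeGroup.of j * FreeGroup.of i *
            (FreeGroup.of j * FreeGroup.of i * FreeGroup.of j)⁻¹) ∨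
      ((i : ℕ) + 2 ≤ (j : ℕ) ∧
        r = FreeGroup.of i * FreeGroup.of j * (FreeGroup.of j * FreeGroup.of i)⁻¹)}

/-- The braid group `B_{n+1}` on `n+1` strands, presented with `n` generators. -/
abbrev Braid (n : ℕ) := PresentedGroup (braidRel n)

/-- `gen n i` is the generator `s_{i+1}` of `B_{n+1}` (for `i < n`). -/
def gen (n i : ℕ) : Braid n :=
  if h : i < n then PresentedGroup.of ⟨i, h⟩ else 1

/-- The product `gen a * gen (a+1) * ⋯ * gen (b-1)`, i.e. `s_{a+1} s_{a+2} ⋯ s_b`. -/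
def seg (n a b : ℕ) : Braid n := (((List.range b).drop a).map (gen n)).prod

/-- The product `gen (b-1) * ⋯ * gen (a+1) * gen a`, i.e. `s_b ⋯ s_{a+2} s_{a+1}`. -/
def segRev (n a b : ℕ) : Braid n := ((((List.range b).drop a).reverse).map (gen n)).prod

/-- The positive braid monoid `B_{n+1}^+`. -/
def Mb (n : ℕ) : Submonoid (Braid n) :=
  Submonoid.closure {x : Braid n | ∃ i : ℕ, i < n ∧ x = gen n i}

/-- The submonoid generated by `s_2, …, s_n`. -/
def M₁b (n : ℕ) : Submonoid (Braid n) :=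
  Submonoid.closure {x : Braid n | ∃ i : ℕ, 1 ≤ i ∧ i < n ∧ x = gen n i}

/-- The submonoid generated by `s_1, …, s_{n-1}`. -/
def Nb (n : ℕ) : Submonoid (Braid n) :=
  Submonoid.closure {x : Braid n | ∃ i : ℕ, i + 1 < n ∧ x = gen n i}

/-- The subgroup generated by `s_2, …, s_n`. -/
def G₁b (n : ℕ) : Subgroup (Braid n) :=
  Subgroup.closure {x : Braid n | ∃ i : ℕ, 1 ≤ i ∧ i < n ∧ x = gen n i}

/-- The subgroup generated by `s_1, …, s_{n-1}`. -/
def Hb (n : ℕ) : Subgroup (Braid n) :=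
  Subgroup.closure {x : Braid n | ∃ i : ℕ, i + 1 < n ∧ x = gen n i}

/-- The Garside element `Δ = (s_1 s_2 ⋯ s_n)^{n+1}`. -/
def Δb (n : ℕ) : Braid n := seg n 0 n ^ (n + 1)

/-- `Δ₁ = (s_2 ⋯ s_n)^n`. -/
def Δ₁b (n : ℕ) : Braid n := seg n 1 n ^ n

/-- `Λ = (s_1 ⋯ s_{n-1})^n`. -/
def Λb (n : ℕ) : Braid n := seg n 0 (n - 1) ^ n

/-- `θ = s_1 ⋯ s_{n-1} s_n² s_{n-1} ⋯ s_1` as an explicit word. -/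
def thetaWordb (n : ℕ) : Braid n := seg n 0 n * segRev n 0 n

end BraidOrder

namespace BraidCurve

/-- The free generator indexed by `b`. -/
def x (b : ℤ) : FreeGroup ℤ := FreeGroup.of b

/-- The elementary twist `x i ↦ x (i+1) (x i)⁻¹ x (i-1)` as an endomorphism. -/
def tauHom (i : ℤ) : FreeGroup ℤ →* FreeGroup ℤ :=
  FreeGroup.lift fun j => if j = i then x (i + 1) * (x i)⁻¹ * x (i - 1) else x j

/-- The inverse of the elementary twist. -/
def tauInv (i : ℤ) : FreeGroup ℤ →* FreeGroup ℤ :=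
  FreeGroup.lift fun j => if j = i then x (i - 1) * (x i)⁻¹ * x (i + 1) else x j

lemma tauHom_x (i j : ℤ) :
    tauHom i (x j) = if j = i then x (i + 1) * (x i)⁻¹ * x (i - 1) else x j := by
  simp [tauHom, x]

lemma tauInv_x (i j : ℤ) :
    tauInv i (x j) = if j = i then x (i - 1) * (x i)⁻¹ * x (i + 1) else x j := by
  simp [tauInv, x]

/-- The elementary twist as an automorphism. -/
def tau (i : ℤ) : MulAut (FreeGroup ℤ) :=
  MonoidHom.toMulEquiv (tauHom i) (tauInv i)
    (by
      ext j
      change tauInv i (tauHom i (x j)) = x j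
      rw [tauHom_x]
      split_ifs with h
      · subst h
        simp [tauInv_x, mul_assoc]
      · simp [tauInv_x, h])
    (by
      ext j
      change tauHom i (tauInv i (x j)) = x j
      rw [tauInv_x]
      split_ifs with h
      · subst h
        simp [tauHom_x, mul_assoc]
      · simp [tauHom_x, h])

lemma tau_x (i j : ℤ) :
    tau i (x j) = if j = i then x (i + 1) * (x i)⁻¹ * x (i - 1) else x j :=
  tauHom_x i j

lemma tau_x_self (i : ℤ) : tau i (x i) = x (i + 1) * (x i)⁻¹ * x (i - 1) := by
  simp [tau_x]

lemma tau_x_ne {i j : ℤ} (h : j ≠ i) : tau i (x j) = x j := by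
  simp [tau_x, h]

lemma mulAut_ext {φ ψ : MulAut (FreeGroup ℤ)} (h : ∀ j, φ (x j) = ψ (x j)) : φ = ψ := by
  have : φ.toMonoidHom = ψ.toMonoidHom := FreeGroup.ext_hom _ _ h
  ext f
  exact DFunLike.congr_fun this f

lemma tau_braid (i : ℤ) :
    tau i * tau (i + 1) * tau i = tau (i + 1) * tau i * tau (i + 1) := by
  apply mulAut_ext
  intro j
  simp only [MulAut.mul_apply]
  by_cases h1 : j = i
  · subst h1
    have e1 : j - 1 ≠ j + 1 := by omega
    have e2 : j + 1 + 1 ≠ j := by omega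
    simp [tau_x, mul_assoc, e1, e2]
  · by_cases h2 : j = i + 1
    · subst h2
      have e1 : i + 1 + 1 ≠ i := by omega
      have e2 : i - 1 ≠ i + 1 := by omega
      simp [tau_x, mul_assoc, e1, e2]
    · simp [tau_x, h1, h2]

lemma tau_comm {i j : ℤ} (hij : i + 2 ≤ j) : tau i * tau j = tau j * tau i := by
  apply mulAut_ext
  intro k
  simp only [MulAut.mul_apply]
  have e1 : i ≠ j := by omega
  have e2 : i + 1 ≠ j := by omega
  have e3 : i - 1 ≠ j := by omega
  have e4 : j + 1 ≠ i := by omega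
  have e5 : j - 1 ≠ i := by omega
  by_cases h1 : k = i
  · subst h1
    simp [tau_x, e1, e2, e3]
  · by_cases h2 : k = j
    · subst h2
      simp [tau_x, e1.symm, e4, e5]
    · simp [tau_x, h1, h2]

/-- The involution `x i ↦ (x (-i))⁻¹`. -/
def mu : FreeGroup ℤ →* FreeGroup ℤ := FreeGroup.lift fun j => (x (-j))⁻¹

@[simp] lemma mu_x (j : ℤ) : mu (x j) = (x (-j))⁻¹ := by simp [mu, x]

@[simp] lemma mu_mu (f : FreeGroup ℤ) : mu (mu f) = f := by
  have : mu.comp mu = MonoidHom.id _ := by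
    ext j
    change mu (mu (x j)) = x j
    simp
  exact DFunLike.congr_fun this f

lemma tau_mu (i : ℤ) (f : FreeGroup ℤ) : tau i (mu f) = mu (tau (-i) f) := by
  have : (tau i).toMonoidHom.comp mu = mu.comp (tau (-i)).toMonoidHom := by
    ext j
    change tau i (mu (x j)) = mu (tau (-i) (x j))
    rw [mu_x, map_inv]
    by_cases h : j = -i
    · subst h
      rw [tau_x_self, neg_neg, tau_x_self]
      simp [mul_assoc, add_comm, sub_eq_add_neg]
    · rw [tau_x_ne h, tau_x_ne (by omega), mu_x]
  exact DFunLike.congr_fun this f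

/-- Prefixing an alternating word by the letter `b`. -/
def T (b : ℤ) (f : FreeGroup ℤ) : FreeGroup ℤ := x b * mu f

lemma T_T_neg (b : ℤ) (f : FreeGroup ℤ) : T b (T (-b) f) = f := by
  simp [T]

lemma tau_T_ne {i b : ℤ} (h : b ≠ i) (f : FreeGroup ℤ) :
    tau i (T b f) = T b (tau (-i) f) := by
  simp [T, tau_mu, tau_x_ne h]

lemma tau_T_self (i : ℤ) (f : FreeGroup ℤ) :
    tau i (T i f) = T (i + 1) (T (-i) (T (i - 1) (tau (-i) f))) := by
  simp [T, tau_mu, tau_x_self, mul_assoc]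

/-- Evaluation of an alternating word. -/
def ev : List ℤ → FreeGroup ℤ
  | [] => 1
  | b :: w => T b (ev w)

@[simp] lemma ev_nil : ev [] = 1 := rfl
lemma ev_cons (b : ℤ) (w : List ℤ) : ev (b :: w) = T b (ev w) := rfl

/-- Reduced alternating words. -/
def Red (w : List ℤ) : Prop := w.IsChain fun b c => c ≠ -b

lemma Red.tail {b : ℤ} {w : List ℤ} (h : Red (b :: w)) : Red w := List.IsChain.tail h

lemma red_cons_cons {b c : ℤ} {w : List ℤ} :
    Red (b :: c :: w) ↔ c ≠ -b ∧ Red (c :: w) := List.isChain_cons_cons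

lemma red_nil : Red [] := List.IsChain.nil
lemma red_singleton (b : ℤ) : Red [b] := List.IsChain.singleton b

/-- The matrix attached to the letter `b`. -/
def letterMat (b : ℤ) : Matrix.SpecialLinearGroup (Fin 2) ℤ :=
  ⟨!![-2 * b, 1 - 4 * b ^ 2; -1, -2 * b], by simp [Matrix.det_fin_two]; ring⟩

/-- The linear representation attaching to a word a point of the projective line. -/
def rho : FreeGroup ℤ →* Matrix.SpecialLinearGroup (Fin 2) ℤ := FreeGroup.lift letterMat

lemma rho_x (b : ℤ) :
    (rho (x b) : Matrix (Fin 2) (Fin 2) ℤ) = !![-2 * b, 1 - 4 * b ^ 2; -1, -2 * b] := by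
  rw [rho, x, FreeGroup.lift_apply_of]
  rfl

lemma rho_mu_x (b : ℤ) : rho (mu (x b)) = -rho (x b) := by
  rw [mu_x, map_inv, inv_eq_iff_mul_eq_one]
  ext i j
  rw [Matrix.SpecialLinearGroup.coe_mul, Matrix.SpecialLinearGroup.coe_neg, rho_x, rho_x]
  fin_cases i <;> fin_cases j <;> simp [Matrix.mul_apply, Fin.sum_univ_two] <;> ring

lemma rho_mu (f : FreeGroup ℤ) : rho (mu f) = rho f ∨ rho (mu f) = -rho f := by
  induction f using FreeGroup.induction_on with
  | C1 => simp
  | of b => exact Or.inr (rho_mu_x b)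
  | inv_of b _ =>
    right
    have := rho_mu_x b
    simp only [x] at this
    rw [map_inv, map_inv, this, map_inv, inv_neg]
  | mul f g hf hg =>
    rw [map_mul, map_mul, map_mul]
    rcases hf with hf | hf <;> rcases hg with hg | hg <;> rw [hf, hg] <;> simp

/-- Numerator of the point of `f`. -/
def P (f : FreeGroup ℤ) : ℤ := (rho f : Matrix (Fin 2) (Fin 2) ℤ) 0 0

/-- Denominator of the point of `f`. -/
def Q (f : FreeGroup ℤ) : ℤ := (rho f : Matrix (Fin 2) (Fin 2) ℤ) 1 0

/-- The point of `f` on the projective line. -/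
def pt (f : FreeGroup ℤ) : ℚ := (P f : ℚ) / Q f

@[simp] lemma P_one : P 1 = 1 := by simp [P]
@[simp] lemma Q_one : Q 1 = 0 := by simp [Q]
@[simp] lemma pt_one : pt 1 = 0 := by simp [pt]

lemma P_mul (f g : FreeGroup ℤ) : P (f * g) =
    (rho f : Matrix (Fin 2) (Fin 2) ℤ) 0 0 * P g + (rho f : Matrix (Fin 2) (Fin 2) ℤ) 0 1 * Q g := by
  simp [P, Q, Matrix.mul_apply, Fin.sum_univ_two]

lemma Q_mul (f g : FreeGroup ℤ) : Q (f * g) =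
    (rho f : Matrix (Fin 2) (Fin 2) ℤ) 1 0 * P g + (rho f : Matrix (Fin 2) (Fin 2) ℤ) 1 1 * Q g := by
  simp [P, Q, Matrix.mul_apply, Fin.sum_univ_two]

lemma PQ_mu (f : FreeGroup ℤ) :
    (P (mu f) = P f ∧ Q (mu f) = Q f) ∨ (P (mu f) = -P f ∧ Q (mu f) = -Q f) := by
  rcases rho_mu f with h | h <;> simp [P, Q, h]

lemma PQ_T (b : ℤ) (f : FreeGroup ℤ) :
    (P (T b f) = -2 * b * P f + (1 - 4 * b ^ 2) * Q f ∧ Q (T b f) = -P f - 2 * b * Q f) ∨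
    (P (T b f) = -(-2 * b * P f + (1 - 4 * b ^ 2) * Q f) ∧
      Q (T b f) = -(-P f - 2 * b * Q f)) := by
  rw [T, P_mul, Q_mul, rho_x]
  rcases PQ_mu f with ⟨h1, h2⟩ | ⟨h1, h2⟩
  · left
    rw [h1, h2]
    simp
    ring
  · right
    rw [h1, h2]
    simp
    constructor <;> ring

lemma pt_T {b : ℤ} {f : FreeGroup ℤ} (hQ : Q f ≠ 0) (h : pt f + 2 * b ≠ 0) :
    Q (T b f) ≠ 0 ∧ pt (T b f) = 2 * b - 1 / (pt f + 2 * b) := by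
  have hq : (Q f : ℚ) ≠ 0 := by exact_mod_cast hQ
  have hP : (P f : ℚ) = pt f * Q f := by simp [pt, hq]
  set z := pt f with hz
  have key : (Q (T b f) : ℚ) ≠ 0 ∧ (P (T b f) : ℚ) / Q (T b f) = 2 * b - 1 / (z + 2 * b) := by
    have e1 : -(P f : ℚ) - 2 * b * Q f = -(z + 2 * b) * Q f := by rw [hP]; ring
    have e2 : -2 * b * (P f : ℚ) + (1 - 4 * b ^ 2) * Q f
        = -(2 * b * (z + 2 * b) - 1) * Q f := by rw [hP]; ring
    have hne : -(z + 2 * b) * (Q f : ℚ) ≠ 0 := mul_ne_zero (neg_ne_zero.2 h) hq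
    rcases PQ_T b f with ⟨h1, h2⟩ | ⟨h1, h2⟩ <;> rw [h1, h2] <;> push_cast <;> rw [e1, e2]
    · refine ⟨hne, ?_⟩
      field_simp
    · refine ⟨neg_ne_zero.2 hne, ?_⟩
      field_simp
  exact ⟨by exact_mod_cast key.1, key.2⟩

lemma pt_T_one (b : ℤ) : Q (T b 1) ≠ 0 ∧ pt (T b 1) = 2 * b := by
  rcases PQ_T b 1 with ⟨h1, h2⟩ | ⟨h1, h2⟩ <;> simp [pt, h1, h2]

lemma ping_pong {b : ℤ} {w : List ℤ} (h : Red (b :: w)) :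
    Q (ev (b :: w)) ≠ 0 ∧ 2 * b - 1 < pt (ev (b :: w)) ∧ pt (ev (b :: w)) < 2 * b + 1 := by
  induction w generalizing b with
  | nil =>
    rw [ev_cons, ev_nil]
    obtain ⟨h1, h2⟩ := pt_T_one b
    rw [h2]
    exact ⟨h1, by linarith, by linarith⟩
  | cons c w ih =>
    obtain ⟨hbc, hr⟩ := red_cons_cons.1 h
    obtain ⟨hq, h1, h2⟩ := ih hr
    rw [ev_cons b]
    set z := pt (ev (c :: w))
    have hz : 1 < z + 2 * b ∨ z + 2 * b < -1 := by
      rcases lt_or_gt_of_ne hbc with h' | h'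
      · right
        have : (c : ℚ) + 1 ≤ -b := by exact_mod_cast h'
        linarith
      · left
        have : -(b : ℚ) + 1 ≤ c := by exact_mod_cast h'
        linarith
    have hne : z + 2 * b ≠ 0 := by
      rcases hz with h | h <;> intro h0 <;> linarith
    obtain ⟨h3, h4⟩ := pt_T hq hne
    refine ⟨h3, ?_⟩
    rw [h4]
    have : -1 < 1 / (z + 2 * b) ∧ 1 / (z + 2 * b) < 1 := by
      rcases hz with h | h
      · have h0 : (0 : ℚ) < z + 2 * b := by linarith
        exact ⟨by have := one_div_pos.2 h0; linarith, by rw [div_lt_one h0]; exact h⟩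
      · have h0 : z + 2 * b < 0 := by linarith
        refine ⟨by rw [lt_div_iff_of_neg h0]; linarith, ?_⟩
        have := one_div_neg.2 h0
        linarith
    constructor <;> linarith [this.1, this.2]

lemma one_div_bounds_pos {s k : ℚ} (hk : 0 < k) (h : k < s) : 0 < 1 / s ∧ 1 / s < 1 / k :=
  ⟨one_div_pos.2 (hk.trans h), one_div_lt_one_div_of_lt hk h⟩

lemma one_div_bounds_neg {s k : ℚ} (hk : 0 < k) (h : s < -k) :
    1 / s < 0 ∧ -(1 / k) < 1 / s := by
  have h1 := one_div_bounds_pos hk (show k < -s by linarith)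
  rw [one_div_neg_eq_neg_one_div] at h1
  constructor <;> linarith [h1.1, h1.2]

lemma pt_ev_cons_cons {b c : ℤ} {w : List ℤ} (h : Red (b :: c :: w)) :
    pt (ev (b :: c :: w)) = 2 * b - 1 / (pt (ev (c :: w)) + 2 * b) ∧
      (c < -b → pt (ev (c :: w)) + 2 * b < -1) ∧ (-b < c → 1 < pt (ev (c :: w)) + 2 * b) := by
  obtain ⟨hbc, hr⟩ := red_cons_cons.1 h
  obtain ⟨hq, h1, h2⟩ := ping_pong hr
  set z := pt (ev (c :: w)) with hz
  have ha : c < -b → z + 2 * b < -1 := fun h' => by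
    have : (c : ℚ) + 1 ≤ -b := by exact_mod_cast h'
    linarith
  have hb : -b < c → 1 < z + 2 * b := fun h' => by
    have : -(b : ℚ) + 1 ≤ c := by exact_mod_cast h'
    linarith
  refine ⟨(pt_T hq ?_).2, ha, hb⟩
  rw [← hz]
  rcases lt_or_gt_of_ne hbc with h' | h'
  · have := ha h'
    intro h0
    linarith
  · have := hb h'
    intro h0
    linarith

lemma pt_gt_of_second_lt {b c : ℤ} {w : List ℤ} (h : Red (b :: c :: w)) (hc : c < -b) :
    2 * b < pt (ev (b :: c :: w)) := by
  obtain ⟨h1, h2, -⟩ := pt_ev_cons_cons h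
  have := (one_div_bounds_neg one_pos (h2 hc)).1
  linarith

lemma pt_lt_of_second_gt {b c : ℤ} {w : List ℤ} (h : Red (b :: c :: w)) (hc : -b < c) :
    pt (ev (b :: c :: w)) < 2 * b := by
  obtain ⟨h1, -, h2⟩ := pt_ev_cons_cons h
  have := (one_div_bounds_pos one_pos (h2 hc)).1
  linarith

lemma pt_T_T_T {i : ℤ} {f : FreeGroup ℤ} (hQ : Q f ≠ 0)
    (h : 8 - 5 * (pt f + 2 * i) ≠ 0) :
    Q (T (i + 1) (T (-i) (T (i - 1) f))) ≠ 0 ∧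
      pt (T (i + 1) (T (-i) (T (i - 1) f)))
        = 2 * i + 8 / 5 + 1 / (5 * (8 - 5 * (pt f + 2 * i))) := by
  have hq : (Q f : ℚ) ≠ 0 := by exact_mod_cast hQ
  have hP : (P f : ℚ) = pt f * Q f := by simp [pt, hq]
  set z := pt f with hz
  have key : ∃ ε : ℚ, ε ≠ 0 ∧
      (Q (T (i + 1) (T (-i) (T (i - 1) f))) : ℚ) = ε * (8 - 5 * (z + 2 * i)) ∧
      (P (T (i + 1) (T (-i) (T (i - 1) f))) : ℚ)
        = ε * (2 * i * (8 - 5 * (z + 2 * i)) + 13 - 8 * (z + 2 * i)) := by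
    rcases PQ_T (i + 1) (T (-i) (T (i - 1) f)) with ⟨h1, h2⟩ | ⟨h1, h2⟩ <;>
    rcases PQ_T (-i) (T (i - 1) f) with ⟨h3, h4⟩ | ⟨h3, h4⟩ <;>
    rcases PQ_T (i - 1) f with ⟨h5, h6⟩ | ⟨h5, h6⟩ <;>
    simp only [h1, h2, h3, h4, h5, h6] <;> push_cast <;> rw [hP] <;>
    first
      | exact ⟨Q f, hq, by ring1, by ring1⟩
      | exact ⟨-Q f, neg_ne_zero.2 hq, by ring1, by ring1⟩
  obtain ⟨ε, hε, h1, h2⟩ := key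
  refine ⟨fun h0 => ?_, ?_⟩
  · rw [h0] at h1
    exact mul_ne_zero hε h (by rw [← h1]; simp)
  · rw [pt, h1, h2]
    generalize 2 * (i : ℚ) = I at *
    generalize hs : z + I = s at *
    field_simp
    ring

/-- Lower bound for the point of a twisted word with head `b`. -/
def lo (i b : ℤ) : ℚ :=
  if b = i then 2 * i + 1 else if b = i + 1 then 2 * i + 5 / 3 else 2 * b - 1

/-- Upper bound for the point of a twisted word with head `b`. -/
def hi (i b : ℤ) : ℚ :=
  if b = i then 2 * i + 5 / 3 else if b = i - 1 then 2 * i + 1 else 2 * b + 1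

lemma lo_ge (i b : ℤ) : 2 * (b : ℚ) - 1 ≤ lo i b := by
  unfold lo
  split_ifs with h1 h2 <;> subst_vars <;> push_cast <;> linarith

lemma hi_le_lo {i b c : ℤ} (h : b < c) : hi i b ≤ lo i c := by
  have h' : (b : ℚ) + 1 ≤ c := by exact_mod_cast h
  unfold lo hi
  split_ifs with h1 h2 h3 h4 h5 h6 h7 <;> subst_vars <;> push_cast at * <;> try linarith
  · have : (b : ℚ) + 2 ≤ c := by exact_mod_cast (show b + 2 ≤ c by omega)
    linarith
  · have : (i : ℚ) + 2 ≤ c := by exact_mod_cast (show i + 2 ≤ c by omega)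
    linarith

lemma twist_bounds {i b : ℤ} {w : List ℤ} (h : Red (b :: w)) :
    Q (tau i (ev (b :: w))) ≠ 0 ∧ lo i b < pt (tau i (ev (b :: w))) ∧
      pt (tau i (ev (b :: w))) < hi i b := by
  induction w generalizing b i with
  | nil =>
    rw [ev_cons, ev_nil]
    by_cases hb : b = i
    · subst hb
      rw [tau_T_self, map_one]
      obtain ⟨h1, h2⟩ := pt_T_one (b - 1)
      have e1 : pt (T (b - 1) 1) + 2 * (-b : ℤ) = -2 := by rw [h2]; push_cast; ring
      obtain ⟨h3, h4⟩ := pt_T (b := -b) h1 (by rw [e1]; norm_num)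
      rw [e1] at h4
      have e2 : pt (T (-b) (T (b - 1) 1)) + 2 * (b + 1 : ℤ) = 5 / 2 := by
        rw [h4]; push_cast; ring
      obtain ⟨h5, h6⟩ := pt_T (b := b + 1) h3 (by rw [e2]; norm_num)
      rw [e2] at h6
      refine ⟨h5, ?_⟩
      rw [h6]
      simp only [lo, hi, if_true]
      push_cast
      constructor <;> linarith
    · rw [tau_T_ne hb, map_one]
      obtain ⟨h1, h2⟩ := pt_T_one b
      refine ⟨h1, ?_⟩
      rw [h2]
      unfold lo hi
      rw [if_neg hb, if_neg hb]
      split_ifs with h3 h4 <;> subst_vars <;> push_cast <;> constructor <;> linarith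
  | cons c w ih =>
    obtain ⟨hbc, hr⟩ := red_cons_cons.1 h
    obtain ⟨hq, hl, hh⟩ := ih (i := -i) hr
    rw [ev_cons b]
    set z := pt (tau (-i) (ev (c :: w))) with hz
    have hcase : (c : ℚ) + b + 1 ≤ 0 ∨ 1 ≤ (c : ℚ) + b := by
      rcases lt_or_gt_of_ne hbc with h' | h'
      · left; exact_mod_cast (show c + b + 1 ≤ 0 by omega)
      · right; exact_mod_cast (show 1 ≤ c + b by omega)
    by_cases hb : b = i
    · subst hb
      rw [tau_T_self]
      have hs : z + 2 * b < 1 ∨ 5 / 3 < z + 2 * b := by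
        rcases hcase with h' | h'
        · left
          by_cases h2 : c = -b - 1
          · simp [hi, h2] at hh
            linarith
          · have : (c : ℚ) + b + 2 ≤ 0 := by
              exact_mod_cast (show c + b + 2 ≤ 0 by
                have : c + b + 1 ≤ 0 := by exact_mod_cast h'
                omega)
            rw [hi, if_neg hbc, if_neg h2] at hh
            linarith
        · right
          by_cases h2 : c = -b + 1
          · simp [lo, h2] at hl
            linarith
          · have : 2 ≤ (c : ℚ) + b := by
              exact_mod_cast (show 2 ≤ c + b by
                have : 1 ≤ c + b := by exact_mod_cast h'
                omega)
            rw [lo, if_neg hbc, if_neg h2] at hl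
            linarith
      have hne : 8 - 5 * (z + 2 * b) ≠ 0 := by
        rcases hs with h' | h' <;> intro h0 <;> linarith
      obtain ⟨h1, h2⟩ := pt_T_T_T hq hne
      refine ⟨h1, ?_⟩
      rw [h2, ← hz]
      simp only [lo, hi, if_true]
      rcases hs with h' | h'
      · have := one_div_bounds_pos (s := 5 * (8 - 5 * (z + 2 * b))) (k := 15) (by norm_num)
          (by linarith)
        constructor <;> linarith [this.1, this.2]
      · have := one_div_bounds_neg (s := 5 * (8 - 5 * (z + 2 * b))) (k := 5 / 3) (by norm_num)
          (by linarith)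
        constructor <;> linarith [this.1, this.2]
    · rw [tau_T_ne hb]
      have hlo := lo_ge (-i) c
      have finish : ∀ k l : ℚ, 0 < k → 0 < l → (k < z + 2 * b ∨ z + 2 * b < -l) →
          Q (T b (tau (-i) (ev (c :: w)))) ≠ 0 ∧
          2 * b - 1 / k < pt (T b (tau (-i) (ev (c :: w)))) ∧
          pt (T b (tau (-i) (ev (c :: w)))) < 2 * b + 1 / l := by
        intro k l hk hl hs
        have hne : z + 2 * b ≠ 0 := by rcases hs with h' | h' <;> intro h0 <;> linarith
        obtain ⟨h1, h2⟩ := pt_T hq hne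
        refine ⟨h1, ?_⟩
        rw [h2, ← hz]
        have h3 := one_div_pos.2 hk
        have h4 := one_div_pos.2 hl
        rcases hs with h' | h'
        · have := one_div_bounds_pos hk h'
          constructor <;> linarith [this.1, this.2]
        · have := one_div_bounds_neg hl h'
          constructor <;> linarith [this.1, this.2]
      by_cases h1 : b = i + 1
      · have hb' : (b : ℚ) = i + 1 := by rw [h1]; push_cast; ring
        obtain ⟨r1, r2, r3⟩ := finish 3 1 (by norm_num) (by norm_num) (by
          rcases hcase with h' | h'
          · right
            have c1 : c ≠ -i := by
              intro h0
              rw [h0, hb'] at h'; push_cast at h'; linarith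
            have c2 : c ≠ -i - 1 := by omega
            rw [hi, if_neg c1, if_neg c2] at hh
            linarith
          · left
            unfold lo at hl
            split_ifs at hl with c1 c2
            · push_cast at hl; linarith
            · push_cast at hl; linarith
            · have : (2 : ℚ) ≤ c + i := by
                exact_mod_cast (show 2 ≤ c + i by
                  have : 1 ≤ c + b := by exact_mod_cast h'
                  omega)
              linarith)
        have e3 : b ≠ i - 1 := by omega
        rw [lo, hi, if_neg hb, if_neg hb, if_pos h1, if_neg e3]
        exact ⟨r1, by linarith, by linarith⟩
      · by_cases h2 : b = i - 1
        · have hb' : (b : ℚ) = i - 1 := by rw [h2]; push_cast; ring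
          obtain ⟨r1, r2, r3⟩ := finish 1 (1 / 3) (by norm_num) (by norm_num) (by
            rcases hcase with h' | h'
            · right
              have : c + i ≤ 0 := by
                have : c + b + 1 ≤ 0 := by exact_mod_cast h'
                omega
              unfold hi at hh
              split_ifs at hh with c1 c2
              · push_cast at hh; linarith
              · push_cast at hh; linarith
              · have : (c : ℚ) + i + 2 ≤ 0 := by exact_mod_cast (show c + i + 2 ≤ 0 by omega)
                linarith
            · left
              linarith)
          rw [lo, hi, if_neg hb, if_neg hb, if_neg h1, if_pos h2]
          norm_num at r3
          exact ⟨r1, by linarith, by linarith⟩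
        · obtain ⟨r1, r2, r3⟩ := finish 1 1 (by norm_num) (by norm_num) (by
            rcases hcase with h' | h'
            · right
              have h'' : c + b + 1 ≤ 0 := by exact_mod_cast h'
              unfold hi at hh
              split_ifs at hh with c1 c2
              · have : (b : ℚ) ≤ i - 2 := by exact_mod_cast (show b ≤ i - 2 by omega)
                push_cast at hh; linarith
              · have : (b : ℚ) ≤ i - 2 := by exact_mod_cast (show b ≤ i - 2 by omega)
                push_cast at hh; linarith
              · linarith
            · left
              linarith)
          rw [lo, hi, if_neg hb, if_neg hb, if_neg h1, if_neg h2]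
          exact ⟨r1, by linarith, by linarith⟩

/-- The determinant of the vectors of `f` and `g`. -/
def D (f g : FreeGroup ℤ) : ℤ := P f * Q g - Q f * P g

/-- The sign of this number is the cyclic orientation of three points. -/
def Ori (f g h : FreeGroup ℤ) : ℤ := D f g * D g h * D h f

lemma D_mul (k f g : FreeGroup ℤ) : D (k * f) (k * g) = D f g := by
  have hdet : (rho k : Matrix (Fin 2) (Fin 2) ℤ) 0 0 * (rho k : Matrix (Fin 2) (Fin 2) ℤ) 1 1 -
      (rho k : Matrix (Fin 2) (Fin 2) ℤ) 0 1 * (rho k : Matrix (Fin 2) (Fin 2) ℤ) 1 0 = 1 := by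
    rw [← Matrix.det_fin_two]
    exact (rho k).2
  rw [D, P_mul, P_mul, Q_mul, Q_mul, D]
  linear_combination (P f * Q g - Q f * P g) * hdet

lemma Ori_mul (k f g h : FreeGroup ℤ) : Ori (k * f) (k * g) (k * h) = Ori f g h := by
  simp only [Ori, D_mul]

lemma Ori_mu (f g h : FreeGroup ℤ) : Ori (mu f) (mu g) (mu h) = Ori f g h := by
  simp only [Ori, D]
  rcases PQ_mu f with ⟨h1, h2⟩ | ⟨h1, h2⟩ <;> rcases PQ_mu g with ⟨h3, h4⟩ | ⟨h3, h4⟩ <;>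
    rcases PQ_mu h with ⟨h5, h6⟩ | ⟨h5, h6⟩ <;> rw [h1, h2, h3, h4, h5, h6] <;> ring

lemma Ori_T (b : ℤ) (f g h : FreeGroup ℤ) : Ori (T b f) (T b g) (T b h) = Ori f g h := by
  simp only [T, Ori_mul, Ori_mu]

lemma Ori_tau_T (i b : ℤ) (f g h : FreeGroup ℤ) :
    Ori (tau i (T b f)) (tau i (T b g)) (tau i (T b h)) =
      Ori (tau (-i) f) (tau (-i) g) (tau (-i) h) := by
  simp only [T, map_mul, tau_mu, Ori_mul, Ori_mu]

lemma Ori_rotate (f g h : FreeGroup ℤ) : Ori f g h = Ori g h f := by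
  simp only [Ori]
  ring

lemma D_eq {f g : FreeGroup ℤ} (hf : Q f ≠ 0) (hg : Q g ≠ 0) :
    (D f g : ℚ) = Q f * Q g * (pt f - pt g) := by
  have hf : (Q f : ℚ) ≠ 0 := by exact_mod_cast hf
  have hg : (Q g : ℚ) ≠ 0 := by exact_mod_cast hg
  simp only [D, pt]
  push_cast
  field_simp

lemma Ori_pos_iff {f g h : FreeGroup ℤ} (hf : Q f ≠ 0) (hg : Q g ≠ 0) (hh : Q h ≠ 0) :
    0 < Ori f g h ↔ 0 < (pt f - pt g) * (pt g - pt h) * (pt h - pt f) := by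
  have e : (Ori f g h : ℚ) =
      (Q f * Q g * Q h) ^ 2 * ((pt f - pt g) * (pt g - pt h) * (pt h - pt f)) := by
    simp only [Ori]
    push_cast
    rw [D_eq hf hg, D_eq hg hh, D_eq hh hf]
    ring
  have hp : (0 : ℚ) < (Q f * Q g * Q h) ^ 2 := by
    have : (Q f : ℚ) * Q g * Q h ≠ 0 := by exact_mod_cast mul_ne_zero (mul_ne_zero hf hg) hh
    positivity
  rw [← Int.cast_pos (R := ℚ), e, mul_pos_iff_of_pos_left hp]

lemma Ori_one_pos_iff {f g : FreeGroup ℤ} (hf : Q f ≠ 0) (hg : Q g ≠ 0) :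
    0 < Ori f g 1 ↔ pt f < pt g := by
  have e : (Ori f g 1 : ℚ) = (Q f * Q g) ^ 2 * (pt g - pt f) := by
    have e1 : D g 1 = -Q g := by simp [D]
    have e2 : D 1 f = Q f := by simp [D]
    simp only [Ori, e1, e2]
    push_cast
    rw [D_eq hf hg]
    ring
  have hp : (0 : ℚ) < (Q f * Q g) ^ 2 := by
    have : (Q f : ℚ) * Q g ≠ 0 := by exact_mod_cast mul_ne_zero hf hg
    positivity
  rw [← Int.cast_pos (R := ℚ), e, mul_pos_iff_of_pos_left hp, sub_pos]

lemma pt_lt_of_head_lt {b c : ℤ} {u v : List ℤ} (hu : Red (b :: u)) (hv : Red (c :: v))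
    (h : b < c) : pt (ev (b :: u)) < pt (ev (c :: v)) := by
  have h' : (b : ℚ) + 1 ≤ c := by exact_mod_cast h
  linarith [(ping_pong hu).2.2, (ping_pong hv).2.1]

lemma pt_tau_lt_of_head_lt {i b c : ℤ} {u v : List ℤ} (hu : Red (b :: u)) (hv : Red (c :: v))
    (h : b < c) : pt (tau i (ev (b :: u))) < pt (tau i (ev (c :: v))) :=
  ((twist_bounds hu).2.2.trans_le (hi_le_lo h)).trans (twist_bounds hv).2.1

lemma sign_of_heads {i b c : ℤ} {u v : List ℤ} (hu : Red (b :: u)) (hv : Red (c :: v))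
    (h : b ≠ c) : SignType.sign (pt (tau i (ev (b :: u))) - pt (tau i (ev (c :: v)))) =
      SignType.sign (pt (ev (b :: u)) - pt (ev (c :: v))) := by
  rcases lt_or_gt_of_ne h with h | h
  · rw [sign_neg (sub_neg.2 (pt_lt_of_head_lt hu hv h)),
      sign_neg (sub_neg.2 (pt_tau_lt_of_head_lt hu hv h))]
  · rw [sign_pos (sub_pos.2 (pt_lt_of_head_lt hv hu h)),
      sign_pos (sub_pos.2 (pt_tau_lt_of_head_lt hv hu h))]

lemma Ori_tau_of_heads {i b c d : ℤ} {u v w : List ℤ} (hu : Red (b :: u)) (hv : Red (c :: v))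
    (hw : Red (d :: w)) (h1 : b ≠ c) (h2 : c ≠ d) (h3 : d ≠ b)
    (h : 0 < Ori (ev (b :: u)) (ev (c :: v)) (ev (d :: w))) :
    0 < Ori (tau i (ev (b :: u))) (tau i (ev (c :: v))) (tau i (ev (d :: w))) := by
  rw [Ori_pos_iff (ping_pong hu).1 (ping_pong hv).1 (ping_pong hw).1, ← sign_eq_one_iff] at h
  rw [Ori_pos_iff (twist_bounds hu).1 (twist_bounds hv).1 (twist_bounds hw).1, ← sign_eq_one_iff,
    sign_mul, sign_mul, sign_of_heads hu hv h1, sign_of_heads hv hw h2, sign_of_heads hw hu h3,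
    ← sign_mul, ← sign_mul]
  exact h

lemma Ori_tau_of_heads_one {i b c : ℤ} {u v : List ℤ} (hu : Red (b :: u)) (hv : Red (c :: v))
    (h1 : b ≠ c) (h : 0 < Ori (ev (b :: u)) (ev (c :: v)) 1) :
    0 < Ori (tau i (ev (b :: u))) (tau i (ev (c :: v))) 1 := by
  rw [Ori_one_pos_iff (ping_pong hu).1 (ping_pong hv).1] at h
  rw [Ori_one_pos_iff (twist_bounds hu).1 (twist_bounds hv).1]
  rcases lt_or_gt_of_ne h1 with h2 | h2
  · exact pt_tau_lt_of_head_lt hu hv h2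
  · exact absurd h (pt_lt_of_head_lt hv hu h2).not_gt

lemma exists_eq_T (b : ℤ) {w : List ℤ} (h : Red w) :
    ∃ v, Red v ∧ ev w = T b (ev v) ∧ v.length ≤ w.length + 1 := by
  cases w with
  | nil => exact ⟨[-b], red_singleton _, by simp [ev_cons, T_T_neg], by simp⟩
  | cons c w =>
    by_cases hc : c = b
    · subst hc
      exact ⟨w, h.tail, rfl, by simp; omega⟩
    · exact ⟨-b :: c :: w, red_cons_cons.2 ⟨by simpa using hc, h⟩, (T_T_neg _ _).symm,
        by simp⟩

lemma Ori_tau_pos (N : ℕ) : ∀ (i : ℤ) (w₁ w₂ w₃ : List ℤ), Red w₁ → Red w₂ → Red w₃ →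
    w₁.length + w₂.length + w₃.length ≤ N → 0 < Ori (ev w₁) (ev w₂) (ev w₃) →
    0 < Ori (tau i (ev w₁)) (tau i (ev w₂)) (tau i (ev w₃)) := by
  induction N with
  | zero =>
    intro i w₁ w₂ w₃ _ _ _ hl h
    obtain rfl : w₁ = [] := List.length_eq_zero_iff.1 (by omega)
    obtain rfl : w₂ = [] := List.length_eq_zero_iff.1 (by omega)
    simp [Ori, D] at h
  | succ N ih =>
    have shared : ∀ (i b : ℤ) (u v w : List ℤ), Red (b :: u) → Red (b :: v) → Red w →
        (b :: u).length + (b :: v).length + w.length ≤ N + 1 →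
        0 < Ori (ev (b :: u)) (ev (b :: v)) (ev w) →
        0 < Ori (tau i (ev (b :: u))) (tau i (ev (b :: v))) (tau i (ev w)) := by
      intro i b u v w hu hv hw hl h
      obtain ⟨w', hw', e, hl'⟩ := exists_eq_T b hw
      rw [e, ev_cons, ev_cons, Ori_T] at h
      rw [e, ev_cons, ev_cons, Ori_tau_T]
      refine ih _ _ _ _ hu.tail hv.tail hw' ?_ h
      simp at hl
      omega
    have main : ∀ (i b c : ℤ) (u v w : List ℤ), Red (b :: u) → Red (c :: v) → Red w →
        (b :: u).length + (c :: v).length + w.length ≤ N + 1 →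
        0 < Ori (ev (b :: u)) (ev (c :: v)) (ev w) →
        0 < Ori (tau i (ev (b :: u))) (tau i (ev (c :: v))) (tau i (ev w)) := by
      intro i b c u v w hu hv hw hl h
      by_cases h1 : b = c
      · subst h1
        exact shared i b u v w hu hv hw hl h
      cases w with
      | nil =>
        rw [ev_nil, map_one]
        exact Ori_tau_of_heads_one hu hv h1 h
      | cons d w =>
        by_cases h2 : c = d
        · subst h2
          rw [Ori_rotate] at h ⊢
          exact shared i c v w (b :: u) hv hw hu (by omega) h
        by_cases h3 : d = b
        · subst h3
          rw [← Ori_rotate] at h ⊢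
          exact shared i d w u (c :: v) hw hu hv (by omega) h
        exact Ori_tau_of_heads hu hv hw h1 h2 h3 h
    intro i w₁ w₂ w₃ h₁ h₂ h₃ hl h
    rcases w₁ with _ | ⟨b, u⟩
    · rcases w₂ with _ | ⟨c, v⟩
      · simp [Ori, D] at h
      · rcases w₃ with _ | ⟨d, w⟩
        · simp [Ori, D] at h
        · rw [Ori_rotate] at h ⊢
          exact main i c d v w [] h₂ h₃ h₁ (by omega) h
    · rcases w₂ with _ | ⟨c, v⟩
      · rcases w₃ with _ | ⟨d, w⟩
        · simp [Ori, D] at h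
        · rw [← Ori_rotate] at h ⊢
          exact main i d b w u [] h₃ h₁ h₂ (by omega) h
      · exact main i b c u v w₃ h₁ h₂ h₃ hl h

lemma D_T (b : ℤ) (f g : FreeGroup ℤ) (h : D (T b f) (T b g) = 0) : D f g = 0 := by
  rw [T, T, D_mul] at h
  simp only [D] at h ⊢
  rcases PQ_mu f with ⟨h1, h2⟩ | ⟨h1, h2⟩ <;> rcases PQ_mu g with ⟨h3, h4⟩ | ⟨h3, h4⟩ <;>
    rw [h1, h2, h3, h4] at h <;> linarith

lemma eq_of_D_eq_zero {u v : List ℤ} (hu : Red u) (hv : Red v) (h : D (ev u) (ev v) = 0) :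
    u = v := by
  induction u generalizing v with
  | nil =>
    cases v with
    | nil => rfl
    | cons c v =>
      simp [D] at h
      exact absurd h (ping_pong hv).1
  | cons b u ih =>
    cases v with
    | nil =>
      simp [D] at h
      exact absurd h (ping_pong hu).1
    | cons c v =>
      by_cases hbc : b = c
      · subst hbc
        rw [ih hu.tail hv.tail (D_T b _ _ h)]
      · exfalso
        have hq := mul_ne_zero (ping_pong hu).1 (ping_pong hv).1
        have hD := D_eq (ping_pong hu).1 (ping_pong hv).1
        have hq' : (Q (ev (b :: u)) : ℚ) * Q (ev (c :: v)) ≠ 0 := by exact_mod_cast hq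
        rw [h, Int.cast_zero, eq_comm, mul_eq_zero] at hD
        have hD := hD.resolve_left hq'
        rcases lt_or_gt_of_ne hbc with h' | h'
        · linarith [pt_lt_of_head_lt hu hv h']
        · linarith [pt_lt_of_head_lt hv hu h']

lemma ev_injective {u v : List ℤ} (hu : Red u) (hv : Red v) (h : ev u = ev v) : u = v := by
  apply eq_of_D_eq_zero hu hv
  rw [h, D]
  ring

/-- Letters at odd positions lie in `[l, r]`, those at even positions in `[-r, -l]`. -/
def Bd : ℤ → ℤ → List ℤ → Prop
  | _, _, [] => True
  | l, r, b :: w => l ≤ b ∧ b ≤ r ∧ Bd (-r) (-l) w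

/-- The group generated by the quotients of the letters `x 0, …, x (n + 1)`. -/
def Fn (n : ℕ) : Subgroup (FreeGroup ℤ) :=
  Subgroup.closure {f | ∃ i j : ℤ, 0 ≤ i ∧ i ≤ n + 1 ∧ 0 ≤ j ∧ j ≤ n + 1 ∧ f = x i * (x j)⁻¹}

/-- Normal forms of the elements of `Fn n`. -/
structure NF (n : ℕ) (w : List ℤ) : Prop where
  red : Red w
  bd : Bd 0 (n + 1) w
  even : Even w.length

lemma exists_T_nf {l r b : ℤ} {w : List ℤ} (hw : Red w) (hbd : Bd (-r) (-l) w) (hl : l ≤ b)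
    (hr : b ≤ r) : ∃ v, Red v ∧ Bd l r v ∧ ev v = T b (ev w) ∧ (Even v.length ↔ ¬ Even w.length) := by
  cases w with
  | nil => exact ⟨[b], red_singleton b, ⟨hl, hr, trivial⟩, rfl, by simp⟩
  | cons c w =>
    by_cases hc : c = -b
    · subst hc
      refine ⟨w, hw.tail, ?_, by rw [ev_cons, T_T_neg], by simp [Nat.even_add_one]⟩
      have := hbd.2.2
      rwa [neg_neg, neg_neg] at this
    · exact ⟨b :: c :: w, red_cons_cons.2 ⟨hc, hw⟩, ⟨hl, hr, hbd⟩, rfl, by simp [Nat.even_add_one]⟩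

lemma x_mul_x_inv_mul (i j : ℤ) (f : FreeGroup ℤ) : x i * (x j)⁻¹ * f = T i (T (-j) f) := by
  simp [T, mul_assoc]

lemma x_mul_x_inv_mem {n : ℕ} {i j : ℤ} (h1 : 0 ≤ i) (h2 : i ≤ n + 1) (h3 : 0 ≤ j)
    (h4 : j ≤ n + 1) : x i * (x j)⁻¹ ∈ Fn n :=
  Subgroup.subset_closure ⟨i, j, h1, h2, h3, h4, rfl⟩

lemma exists_nf {n : ℕ} {f : FreeGroup ℤ} (hf : f ∈ Fn n) : ∃ w, NF n w ∧ ev w = f := by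
  have step : ∀ (i j : ℤ) (f : FreeGroup ℤ), 0 ≤ i → i ≤ n + 1 → 0 ≤ j → j ≤ n + 1 →
      (∃ w, NF n w ∧ ev w = f) → ∃ w, NF n w ∧ ev w = x i * (x j)⁻¹ * f := by
    rintro i j f h1 h2 h3 h4 ⟨w, hw, rfl⟩
    have hbd : Bd (-(0 : ℤ)) (-(-((n : ℤ) + 1))) w := by simpa using hw.bd
    obtain ⟨u, hu, hub, hue, hup⟩ := exists_T_nf (b := -j) hw.red (r := 0) (l := -((n : ℤ) + 1))
      hbd (by omega) (by omega)
    obtain ⟨v, hv, hvb, hve, hvp⟩ := exists_T_nf (b := i) hu (r := (n : ℤ) + 1) (l := 0)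
      (by simpa using hub) h1 h2
    exact ⟨v, ⟨hv, hvb, by rw [hvp, hup]; simpa using hw.even⟩, by rw [hve, hue, x_mul_x_inv_mul]⟩
  induction hf using Subgroup.closure_induction_left with
  | one => exact ⟨[], ⟨red_nil, trivial, by simp⟩, rfl⟩
  | mul_left g hg f _ ih =>
    obtain ⟨i, j, h1, h2, h3, h4, rfl⟩ := hg
    exact step i j f h1 h2 h3 h4 ih
  | inv_mul_cancel g hg f _ ih =>
    obtain ⟨i, j, h1, h2, h3, h4, rfl⟩ := hg
    rw [mul_inv_rev, inv_inv]
    exact step j i f h3 h4 h1 h2 ih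

lemma cons_of_ne_one {w : List ℤ} (h : ev w ≠ 1) : ∃ b v, w = b :: v := by
  cases w with
  | nil => exact absurd rfl h
  | cons b v => exact ⟨b, v, rfl⟩

lemma exists_cons_nf {n : ℕ} {f : FreeGroup ℤ} (hf : f ∈ Fn n) (h1 : f ≠ 1) :
    ∃ b c w, NF n (b :: c :: w) ∧ ev (b :: c :: w) = f := by
  obtain ⟨w, hw, rfl⟩ := exists_nf hf
  obtain ⟨b, v, rfl⟩ := cons_of_ne_one h1
  cases v with
  | nil =>
    have := hw.even
    simp at this
  | cons c v => exact ⟨b, c, v, hw, rfl⟩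

lemma pt_injective {n : ℕ} {f g : FreeGroup ℤ} (hf : f ∈ Fn n) (hg : g ∈ Fn n) (hf1 : f ≠ 1)
    (hg1 : g ≠ 1) (h : pt f = pt g) : f = g := by
  obtain ⟨b, c, u, hu, rfl⟩ := exists_cons_nf hf hf1
  obtain ⟨b', c', v, hv, rfl⟩ := exists_cons_nf hg hg1
  rw [eq_of_D_eq_zero hu.red hv.red]
  have := D_eq (ping_pong hu.red).1 (ping_pong hv.red).1
  rw [h, sub_self, mul_zero] at this
  exact_mod_cast this

lemma pt_tau_lt_of_lt {n : ℕ} {f g : FreeGroup ℤ} (i : ℤ) (hf : f ∈ Fn n) (hg : g ∈ Fn n)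
    (hf1 : f ≠ 1) (hg1 : g ≠ 1) (h : pt f < pt g) : pt (tau i f) < pt (tau i g) := by
  obtain ⟨b, c, u, hu, rfl⟩ := exists_cons_nf hf hf1
  obtain ⟨b', c', v, hv, rfl⟩ := exists_cons_nf hg hg1
  rw [← Ori_one_pos_iff (ping_pong hu.red).1 (ping_pong hv.red).1, ← ev_nil] at h
  have := Ori_tau_pos _ i _ _ _ hu.red hv.red red_nil le_rfl h
  rw [ev_nil, map_one] at this
  rwa [Ori_one_pos_iff (twist_bounds hu.red).1 (twist_bounds hv.red).1] at this

lemma pt_tau_lt_iff {n : ℕ} {f g : FreeGroup ℤ} (i : ℤ) (hf : f ∈ Fn n) (hg : g ∈ Fn n)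
    (hf1 : f ≠ 1) (hg1 : g ≠ 1) : pt (tau i f) < pt (tau i g) ↔ pt f < pt g := by
  refine ⟨fun h => ?_, pt_tau_lt_of_lt i hf hg hf1 hg1⟩
  rcases lt_trichotomy (pt f) (pt g) with h' | h' | h'
  · exact h'
  · rw [pt_injective hf hg hf1 hg1 h'] at h
    exact absurd h (lt_irrefl _)
  · exact absurd h (pt_tau_lt_of_lt i hg hf hg1 hf1 h').not_gt

lemma tau_mem {n : ℕ} {i : ℤ} (h1 : 1 ≤ i) (h2 : i ≤ n) {f : FreeGroup ℤ} (hf : f ∈ Fn n) :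
    tau i f ∈ Fn n := by
  have key : ∀ j : ℤ, 0 ≤ j → j ≤ n + 1 → tau i (x j) * (x 0)⁻¹ ∈ Fn n := by
    intro j hj hj'
    by_cases h : j = i
    · subst h
      rw [tau_x_self]
      have := (Fn n).mul_mem (x_mul_x_inv_mem (n := n) (i := j + 1) (j := j) (by omega) (by omega)
        hj hj') (x_mul_x_inv_mem (n := n) (i := j - 1) (j := 0) (by omega) (by omega) le_rfl
          (by omega))
      simpa [mul_assoc] using this
    · rw [tau_x_ne h]
      exact x_mul_x_inv_mem hj hj' le_rfl (by omega)
  have : Fn n ≤ (Fn n).comap (tau i).toMonoidHom := by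
    rw [Fn, Subgroup.closure_le]
    rintro _ ⟨j, k, hj, hj', hk, hk', rfl⟩
    change tau i (x j * (x k)⁻¹) ∈ Fn n
    have := (Fn n).mul_mem (key j hj hj') ((Fn n).inv_mem (key k hk hk'))
    simpa using this
  exact this hf

lemma tau_inv_mem {n : ℕ} {i : ℤ} (h1 : 1 ≤ i) (h2 : i ≤ n) {f : FreeGroup ℤ} (hf : f ∈ Fn n) :
    (tau i)⁻¹ f ∈ Fn n := by
  have key : ∀ j : ℤ, 0 ≤ j → j ≤ n + 1 → tauInv i (x j) * (x 0)⁻¹ ∈ Fn n := by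
    intro j hj hj'
    rw [tauInv_x]
    split_ifs with h
    · subst h
      have := (Fn n).mul_mem (x_mul_x_inv_mem (n := n) (i := j - 1) (j := j) (by omega) (by omega)
        hj hj') (x_mul_x_inv_mem (n := n) (i := j + 1) (j := 0) (by omega) (by omega) le_rfl
          (by omega))
      simpa [mul_assoc] using this
    · exact x_mul_x_inv_mem hj hj' le_rfl (by omega)
  have : Fn n ≤ (Fn n).comap (tauInv i) := by
    rw [Fn, Subgroup.closure_le]
    rintro _ ⟨j, k, hj, hj', hk, hk', rfl⟩
    change tauInv i (x j * (x k)⁻¹) ∈ Fn n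
    have := (Fn n).mul_mem (key j hj hj') ((Fn n).inv_mem (key k hk hk'))
    simpa using this
  exact this hf

/-- The points far to the left of the letter `l`. -/
def InA (l : ℤ) (f : FreeGroup ℤ) : Prop := pt f < 2 * l - 1

/-- The points of words with head `l` and second letter below `-l`. -/
def InB (l : ℤ) (f : FreeGroup ℤ) : Prop := 2 * l < pt f ∧ pt f < 2 * l + 1

lemma inA_one {l : ℤ} (hl : 1 ≤ l) : InA l 1 := by
  have : (1 : ℚ) ≤ l := by exact_mod_cast hl
  rw [InA, pt_one]
  linarith

lemma not_inB_one {l : ℤ} (hl : 1 ≤ l) : ¬ InB l 1 := by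
  have : (1 : ℚ) ≤ l := by exact_mod_cast hl
  rw [InB, pt_one]
  intro h
  linarith [h.1]

lemma inA_iff {l b : ℤ} {w : List ℤ} (h : Red (b :: w)) : InA l (ev (b :: w)) ↔ b < l := by
  obtain ⟨-, h1, h2⟩ := ping_pong h
  rw [InA]
  constructor
  · intro h3
    by_contra hbl
    have : (l : ℚ) ≤ b := by exact_mod_cast not_lt.1 hbl
    linarith
  · intro h3
    have : (b : ℚ) + 1 ≤ l := by exact_mod_cast h3
    linarith

lemma eq_of_window {l b : ℤ} {z : ℚ} (h1 : 2 * (b : ℚ) - 1 < z) (h2 : z < 2 * b + 1)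
    (h3 : 2 * (l : ℚ) < z) (h4 : z < 2 * l + 1) : b = l := by
  have e1 : (b : ℚ) < l + 1 := by linarith
  have e2 : (l : ℚ) < b + 1 := by linarith
  have e1 : b < l + 1 := by exact_mod_cast e1
  have e2 : l < b + 1 := by exact_mod_cast e2
  omega

lemma inB_iff {l b c : ℤ} {w : List ℤ} (h : Red (b :: c :: w)) :
    InB l (ev (b :: c :: w)) ↔ b = l ∧ c < -l := by
  obtain ⟨-, h1, h2⟩ := ping_pong h
  rw [InB]
  constructor
  · rintro ⟨h3, h4⟩
    obtain rfl := eq_of_window h1 h2 h3 h4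
    refine ⟨rfl, ?_⟩
    by_contra hc
    have := pt_lt_of_second_gt h (lt_of_le_of_ne (not_lt.1 hc) (red_cons_cons.1 h).1.symm)
    linarith
  · rintro ⟨rfl, hc⟩
    exact ⟨pt_gt_of_second_lt h hc, h2⟩

lemma second_lt_of_pt_tau_gt {i b c : ℤ} {w : List ℤ} (hbi : b ≠ i) (h : Red (b :: c :: w))
    (hp : 2 * b < pt (tau i (ev (b :: c :: w)))) : c < -b := by
  obtain ⟨hbc, hr⟩ := red_cons_cons.1 h
  by_contra hc
  have hc : -b < c := lt_of_le_of_ne (not_lt.1 hc) hbc.symm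
  obtain ⟨hq, h1, -⟩ := twist_bounds (i := -i) hr
  have h2 := lo_ge (-i) c
  have hc' : -(b : ℚ) + 1 ≤ c := by exact_mod_cast hc
  have hs : 1 < pt (tau (-i) (ev (c :: w))) + 2 * b := by linarith
  rw [ev_cons b, tau_T_ne hbi, (pt_T hq (by linarith)).2] at hp
  have := (one_div_bounds_pos one_pos hs).1
  linarith

lemma inA_of_tau {n : ℕ} {l : ℤ} (hl : 1 ≤ l) (i : ℤ) {f : FreeGroup ℤ} (hf : f ∈ Fn n)
    (h : InA l (tau i f)) : InA l f := by
  by_cases hf1 : f = 1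
  · subst hf1
    exact inA_one hl
  obtain ⟨b, c, w, hw, rfl⟩ := exists_cons_nf hf hf1
  rw [inA_iff hw.red]
  obtain ⟨-, h1, -⟩ := twist_bounds (i := i) hw.red
  have h2 := lo_ge i b
  rw [InA] at h
  have : (b : ℚ) < l := by linarith
  exact_mod_cast this

lemma inB_of_tau {n : ℕ} {l i : ℤ} (hl : 1 ≤ l) (hil : i ≠ l) {f : FreeGroup ℤ} (hf : f ∈ Fn n)
    (h : InB l (tau i f)) : InB l f := by
  by_cases hf1 : f = 1
  · subst hf1
    rw [map_one] at h
    exact absurd h (not_inB_one hl)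
  obtain ⟨b, c, w, hw, rfl⟩ := exists_cons_nf hf hf1
  rw [inB_iff hw.red]
  obtain ⟨-, h1, h2⟩ := twist_bounds (i := i) hw.red
  have hlo := lo_ge i b
  have hbl : b = l := by
    obtain ⟨h3, h4⟩ := h
    unfold hi at h2
    split_ifs at h2 with c1 c2
    · subst c1
      simp only [lo, if_true] at h1
      have e1 : (b : ℚ) < l := by linarith
      have e2 : (l : ℚ) < b + 1 := by linarith
      have e1 : b < l := by exact_mod_cast e1
      have e2 : l < b + 1 := by exact_mod_cast e2
      omega
    · have e1 : (l : ℚ) < i + 1 := by linarith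
      have e2 : (b : ℚ) < l + 1 := by linarith
      have e1 : l < i + 1 := by exact_mod_cast e1
      have e2 : b < l + 1 := by exact_mod_cast e2
      omega
    · exact eq_of_window (by linarith) h2 h3 h4
  subst hbl
  exact ⟨rfl, second_lt_of_pt_tau_gt hil.symm hw.red h.1⟩

lemma inA_down {n : ℕ} {l : ℤ} (hl : 2 ≤ l) (hln : l ≤ n) {f : FreeGroup ℤ} (hf : f ∈ Fn n)
    (h : InA l (tau (l - 1) (tau l f))) : InA (l - 1) f := by
  apply inA_of_tau (by omega) l hf
  have hf' := tau_mem (by omega) hln hf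
  have h' := inA_of_tau (by omega) _ hf' h
  by_cases hf1 : tau l f = 1
  · rw [hf1]
    exact inA_one (by omega)
  obtain ⟨b, c, w, hw, e⟩ := exists_cons_nf hf' hf1
  rw [← e] at h h' ⊢
  rw [inA_iff hw.red] at h' ⊢
  by_contra hb
  obtain rfl : b = l - 1 := by omega
  obtain ⟨-, h1, -⟩ := twist_bounds (i := l - 1) hw.red
  simp only [lo, if_true] at h1
  rw [InA] at h
  push_cast at h1
  linarith

lemma inB_down {n : ℕ} {l : ℤ} (hl : 2 ≤ l) (hln : l ≤ n) {f : FreeGroup ℤ} (hf : f ∈ Fn n)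
    (h : InB l (tau (l - 1) (tau l f))) : InB (l - 1) f := by
  have hf' := tau_mem (by omega) hln hf
  have h' := inB_of_tau (by omega) (by omega) hf' h
  by_cases hf1 : f = 1
  · subst hf1
    rw [map_one] at h'
    exact absurd h' (not_inB_one (by omega))
  obtain ⟨b, c, w, hw, rfl⟩ := exists_cons_nf hf hf1
  rw [inB_iff hw.red]
  obtain ⟨-, h1, h2⟩ := twist_bounds (i := l) hw.red
  have hlo := lo_ge l b
  obtain ⟨h3, h4⟩ := h'
  have hb : b = l - 1 := by
    by_contra hb
    have hbl : b ≠ l := by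
      rintro rfl
      simp only [lo, if_true] at h1
      linarith
    rw [hi, if_neg hbl, if_neg hb] at h2
    exact hbl (eq_of_window (by linarith) h2 h3 h4)
  subst hb
  refine ⟨rfl, second_lt_of_pt_tau_gt (i := l) (by omega) hw.red ?_⟩
  push_cast
  linarith

lemma tau_shift (l : ℤ) (g : FreeGroup ℤ) :
    tau l (x l * (x (l - 1))⁻¹ * g) = T (l + 1) (T (-l) (tau l g)) := by
  rw [← x_mul_x_inv_mul, map_mul, map_mul, map_inv, tau_x_self, tau_x_ne (by omega)]
  group

lemma inA_up {n : ℕ} {l : ℤ} (hl : 1 ≤ l) (hln : l ≤ n) {f : FreeGroup ℤ} (hf : f ∈ Fn n)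
    (h : InA l (tau (l + 1) (tau l f))) : InA (l + 1) (x l * (x (l - 1))⁻¹ * f) := by
  have hf' := tau_mem (by omega) hln hf
  have h' := inA_of_tau (by omega) _ hf' h
  have hk : x l * (x (l - 1))⁻¹ * f ∈ Fn n :=
    (Fn n).mul_mem (x_mul_x_inv_mem (by omega) (by omega) (by omega) (by omega)) hf
  have key : pt (tau l (x l * (x (l - 1))⁻¹ * f)) < 2 * l + 5 / 3 := by
    rw [tau_shift]
    have : Q (T (-l) (tau l f)) ≠ 0 ∧ -2 * (l : ℚ) ≤ pt (T (-l) (tau l f)) ∧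
        pt (T (-l) (tau l f)) < -2 * l + 1 := by
      by_cases hf1 : tau l f = 1
      · rw [hf1]
        obtain ⟨h1, h2⟩ := pt_T_one (-l)
        refine ⟨h1, ?_⟩
        rw [h2]
        push_cast
        constructor <;> linarith
      · obtain ⟨b, c, w, hw, e⟩ := exists_cons_nf hf' hf1
        rw [InA] at h'
        have hq : Q (tau l f) ≠ 0 := by
          rw [← e]
          exact (ping_pong hw.red).1
        have hs : pt (tau l f) + 2 * (-l : ℤ) < -1 := by push_cast; linarith
        obtain ⟨h1, h2⟩ := pt_T hq (b := -l) (by linarith)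
        refine ⟨h1, ?_⟩
        rw [h2]
        have := one_div_bounds_neg one_pos hs
        push_cast at this ⊢
        constructor <;> linarith [this.1, this.2]
    obtain ⟨h1, h2, h3⟩ := this
    have hs : 0 < pt (T (-l) (tau l f)) + 2 * (l + 1 : ℤ) := by push_cast; linarith
    rw [(pt_T h1 hs.ne').2]
    have := one_div_lt_one_div_of_lt hs
      (show pt (T (-l) (tau l f)) + 2 * (l + 1 : ℤ) < 3 by push_cast; linarith)
    push_cast at this ⊢
    linarith
  by_cases hk1 : x l * (x (l - 1))⁻¹ * f = 1
  · rw [hk1]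
    exact inA_one (by omega)
  obtain ⟨b, c, w, hw, e⟩ := exists_cons_nf hk hk1
  rw [← e] at key ⊢
  rw [inA_iff hw.red]
  obtain ⟨-, h1, -⟩ := twist_bounds (i := l) hw.red
  unfold lo at h1
  split_ifs at h1 with c1 c2
  · omega
  · linarith
  · have : (b : ℚ) < l + 2 := by linarith
    have : b < l + 2 := by exact_mod_cast this
    omega

lemma inB_up {n : ℕ} {l : ℤ} (hl : 1 ≤ l) (hln : l ≤ n) {f : FreeGroup ℤ} (hf : f ∈ Fn n)
    (h : InB l (tau (l + 1) (tau l f))) : InB (l + 1) (x l * (x (l - 1))⁻¹ * f) := by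
  have hf' := tau_mem (by omega) hln hf
  have h' := inB_of_tau (by omega) (by omega) hf' h
  have hk : x l * (x (l - 1))⁻¹ * f ∈ Fn n :=
    (Fn n).mul_mem (x_mul_x_inv_mem (by omega) (by omega) (by omega) (by omega)) hf
  apply inB_of_tau (i := l) (by omega) (by omega) hk
  rw [tau_shift]
  by_cases hf1 : tau l f = 1
  · rw [hf1] at h'
    exact absurd h' (not_inB_one (by omega))
  obtain ⟨b, c, w, hw, e⟩ := exists_cons_nf hf' hf1
  rw [← e] at h h' ⊢
  rw [inB_iff hw.red] at h'
  obtain ⟨rfl, hc⟩ := h'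
  have hc' : c ≠ -b - 1 := by
    rintro rfl
    obtain ⟨-, hr⟩ := red_cons_cons.1 hw.red
    obtain ⟨hq, h1, h2⟩ := twist_bounds (i := -(b + 1)) hr
    rw [show -b - 1 = -(b + 1) by ring] at h1 h2 hq
    simp only [lo, hi, if_true] at h1 h2
    have hs1 : -1 < pt (tau (-(b + 1)) (ev (-(b + 1) :: w))) + 2 * b := by
      push_cast at h1; linarith
    have hs2 : pt (tau (-(b + 1)) (ev (-(b + 1) :: w))) + 2 * b < -(1 / 3) := by
      push_cast at h2; linarith
    obtain ⟨-, h4⟩ := h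
    rw [ev_cons b, tau_T_ne (by omega), show -b - 1 = -(b + 1) by ring,
      (pt_T hq (by linarith)).2] at h4
    have : 1 < 1 / -(pt (tau (-(b + 1)) (ev (-(b + 1) :: w))) + 2 * b) :=
      (one_lt_div (by linarith)).2 (by linarith)
    rw [one_div_neg_eq_neg_one_div] at this
    linarith
  rw [ev_cons b, show T (-b) (T b (ev (c :: w))) = ev (c :: w) by
    simpa using T_T_neg (-b) (ev (c :: w)), ← ev_cons]
  rw [inB_iff (red_cons_cons.2 ⟨by omega, hw.red.tail⟩)]
  exact ⟨rfl, by omega⟩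

/-- The arc `α` passes through the window attached to `l`. -/
def Arc (n : ℕ) (l : ℤ) (α : FreeGroup ℤ) : Prop :=
  ∃ f ∈ Fn n, (InA l f ∧ InB l (f * α)) ∨ (InA l (f * α) ∧ InB l f)

lemma arc_of_tau {n : ℕ} {l i : ℤ} {α : FreeGroup ℤ} (hα : α ∈ Fn n) (hl : 1 ≤ l) (hi1 : 1 ≤ i)
    (hin : i ≤ n) (hil : i ≠ l) (h : Arc n l (tau i α)) : Arc n l α := by
  obtain ⟨f, hf, h⟩ := h
  have hf' := tau_inv_mem hi1 hin hf
  have e : tau i ((tau i)⁻¹ f) = f := MulAut.apply_inv_self _ _ _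
  rw [← e, ← map_mul] at h
  have hm := (Fn n).mul_mem hf' hα
  exact ⟨_, hf', h.imp (fun h => ⟨inA_of_tau hl i hf' h.1, inB_of_tau hl hil hm h.2⟩)
    (fun h => ⟨inA_of_tau hl i hm h.1, inB_of_tau hl hil hf' h.2⟩)⟩

lemma arc_down {n : ℕ} {l : ℤ} {α : FreeGroup ℤ} (hα : α ∈ Fn n) (hl : 2 ≤ l) (hln : l ≤ n)
    (h : Arc n l (tau (l - 1) (tau l α))) : Arc n (l - 1) α := by
  obtain ⟨f, hf, h⟩ := h
  have hf' := tau_inv_mem (by omega) hln (tau_inv_mem (i := l - 1) (by omega) (by omega) hf)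
  have e : tau (l - 1) (tau l ((tau l)⁻¹ ((tau (l - 1))⁻¹ f))) = f := by
    rw [MulAut.apply_inv_self, MulAut.apply_inv_self]
  rw [← e, ← map_mul, ← map_mul] at h
  have hm := (Fn n).mul_mem hf' hα
  exact ⟨_, hf', h.imp (fun h => ⟨inA_down hl hln hf' h.1, inB_down hl hln hm h.2⟩)
    (fun h => ⟨inA_down hl hln hm h.1, inB_down hl hln hf' h.2⟩)⟩

lemma arc_up {n : ℕ} {l : ℤ} {α : FreeGroup ℤ} (hα : α ∈ Fn n) (hl : 1 ≤ l) (hln : l + 1 ≤ n)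
    (h : Arc n l (tau (l + 1) (tau l α))) : Arc n (l + 1) α := by
  obtain ⟨f, hf, h⟩ := h
  have hln' : l ≤ n := by omega
  have hf' := tau_inv_mem (by omega) hln' (tau_inv_mem (i := l + 1) (by omega) (by omega) hf)
  have e : tau (l + 1) (tau l ((tau l)⁻¹ ((tau (l + 1))⁻¹ f))) = f := by
    rw [MulAut.apply_inv_self, MulAut.apply_inv_self]
  rw [← e, ← map_mul, ← map_mul] at h
  have hm := (Fn n).mul_mem hf' hα
  refine ⟨x l * (x (l - 1))⁻¹ * _, (Fn n).mul_mem (x_mul_x_inv_mem (by omega) (by omega) (by omega)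
    (by omega)) hf', ?_⟩
  rw [mul_assoc _ _ α]
  exact h.imp (fun h => ⟨inA_up hl hln' hf' h.1, inB_up hl hln' hm h.2⟩)
    (fun h => ⟨inA_up hl hln' hm h.1, inB_up hl hln' hf' h.2⟩)

lemma ev_append (u v : List ℤ) : ev (u ++ v) = ev u * mu^[u.length] (ev v) := by
  induction u with
  | nil => simp
  | cons b u ih =>
    rw [List.cons_append, ev_cons, ih, ev_cons, T, T, map_mul, List.length_cons,
      Function.iterate_succ_apply', mul_assoc]

lemma mu_iterate_even {k : ℕ} (hk : Even k) (f : FreeGroup ℤ) : mu^[k] f = f := by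
  obtain ⟨m, rfl⟩ := hk
  rw [← two_mul, Function.iterate_mul]
  have : mu^[2] = id := by
    funext g
    simp
  rw [this, Function.iterate_id, id]

lemma ev_append_even {u : List ℤ} (hu : Even u.length) (v : List ℤ) :
    ev (u ++ v) = ev u * ev v := by
  rw [ev_append, mu_iterate_even hu]

lemma ev_append_odd {u : List ℤ} (hu : ¬ Even u.length) (v : List ℤ) :
    ev (u ++ v) = ev u * mu (ev v) := by
  rw [ev_append]
  obtain ⟨m, hm⟩ := Nat.not_even_iff_odd.1 hu
  rw [hm, ← Nat.succ_eq_add_one, Function.iterate_succ_apply', mu_iterate_even (even_two_mul m)]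

lemma ev_pair (i j : ℤ) : ev [i, -j] = x i * (x j)⁻¹ := by
  rw [ev_cons, ev_cons, ev_nil, ← x_mul_x_inv_mul, mul_one]

/-- The effect on normal forms of right multiplication by `x 0 * (x m)⁻¹`. -/
lemma ev_mul_quot {m b c : ℤ} {w : List ℤ} (hm : m ≠ 0) (h : Red (b :: c :: w))
    (he : Even w.length) :
    (∃ w', Red (b :: c :: w') ∧ ev (b :: c :: w) * (x 0 * (x m)⁻¹) = ev (b :: c :: w') ∧
      (w.head? = w'.head? ∨ w = [] ∨ w' = [])) ∨
    (c = 0 ∧ w = [] ∧ b ≠ m ∧ ev (b :: c :: w) * (x 0 * (x m)⁻¹) = ev [b, -m]) ∨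
    (b = m ∧ c = 0 ∧ w = [] ∧ ev (b :: c :: w) * (x 0 * (x m)⁻¹) = 1) := by
  have hu : Even (b :: c :: w).length := by simpa [Nat.even_add_one] using he
  rcases List.eq_nil_or_concat' w with rfl | ⟨w₀, d, rfl⟩
  · by_cases hc : c = 0
    · subst hc
      right
      have e : ev [b, 0] * (x 0 * (x m)⁻¹) = x b * (x m)⁻¹ := by
        rw [show [b, (0 : ℤ)] = [b, -0] by simp, ev_pair]
        group
      by_cases hb : b = m
      · right
        subst hb
        exact ⟨rfl, rfl, rfl, by rw [e]; group⟩
      · left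
        exact ⟨rfl, rfl, hb, by rw [e, ev_pair]⟩
    · left
      refine ⟨[0, -m], ?_, ?_, Or.inr (Or.inl rfl)⟩
      · rw [red_cons_cons, red_cons_cons, red_cons_cons]
        exact ⟨(red_cons_cons.1 h).1, by omega, by omega, red_singleton _⟩
      · rw [← ev_pair, ← ev_append_even hu]
        rfl
  · left
    have hw₀ : ¬ Even w₀.length := by simpa [Nat.even_add_one] using he
    have hv : ¬ Even (b :: c :: w₀).length := by simpa [Nat.even_add_one] using hw₀
    obtain ⟨v, a, rfl⟩ : ∃ v a, w₀ = v ++ [a] := by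
      rcases List.eq_nil_or_concat' w₀ with rfl | h
      · simp at hw₀
      · exact h
    have hr : Red (b :: c :: v ++ [a]) := by
      have : Red ((b :: c :: v ++ [a]) ++ [d]) := by simpa using h
      exact List.IsChain.left_of_append this
    have hda : d ≠ -a := by
      have : Red ((b :: c :: v) ++ [a, d]) := by simpa using h
      exact (red_cons_cons.1 (List.IsChain.right_of_append this)).1
    have snoc : ∀ d', d' ≠ -a → Red (b :: c :: v ++ [a, d']) := by
      intro d' hd'
      exact List.isChain_split.2 ⟨hr, red_cons_cons.2 ⟨hd', red_singleton _⟩⟩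
    by_cases hd : d = 0
    · subst hd
      have e : ev (b :: c :: ((v ++ [a]) ++ [0])) * (x 0 * (x m)⁻¹)
          = ev (b :: c :: (v ++ [a])) * (x m)⁻¹ := by
        rw [← List.cons_append, ← List.cons_append, ev_append_odd hv, ev_cons 0, ev_nil, T]
        simp [mul_assoc]
      have hve : Even (b :: c :: v).length := by
        simpa [Nat.even_add_one] using hv
      by_cases ha : a = m
      · subst ha
        refine ⟨v, List.IsChain.left_of_append hr, ?_, ?_⟩
        · rw [e, ← List.cons_append, ← List.cons_append, ev_append_even hve, ev_cons a, ev_nil, T]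
          simp
        · cases v <;> simp
      · refine ⟨v ++ [a, -m], by simpa using snoc (-m) (by omega), ?_, ?_⟩
        · rw [e, show b :: c :: (v ++ [a, -m]) = (b :: c :: (v ++ [a])) ++ [-m] by simp,
            ev_append_odd hv, ev_cons (-m), ev_nil, T]
          simp
        · left
          cases v <;> simp
    · refine ⟨v ++ [a, d, 0, -m], ?_, ?_, ?_⟩
      · exact List.isChain_split (l₁ := b :: c :: v).2 ⟨hr, red_cons_cons.2 ⟨hda,
          red_cons_cons.2 ⟨by omega, red_cons_cons.2 ⟨by omega, red_singleton _⟩⟩⟩⟩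
      · rw [← ev_pair, ← ev_append_even hu]
        simp
      · left
        cases v <;> simp

lemma inA_mul_quot {n : ℕ} {m l : ℤ} (hm : 0 < m) (hl : 1 ≤ l) {f : FreeGroup ℤ} (hf : f ∈ Fn n)
    (h : InA l f) : InA l (f * (x 0 * (x m)⁻¹)) := by
  by_cases hf1 : f = 1
  · subst hf1
    rw [one_mul, ← ev_pair, inA_iff (red_cons_cons.2 ⟨by omega, red_singleton _⟩)]
    omega
  obtain ⟨b, c, w, hw, rfl⟩ := exists_cons_nf hf hf1
  rw [inA_iff hw.red] at h
  have he : Even w.length := by simpa [Nat.even_add_one] using hw.even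
  rcases ev_mul_quot hm.ne' hw.red he with ⟨w', hw', e, -⟩ | ⟨hc, hw0, hb, e⟩ | ⟨-, -, -, e⟩
  · rw [e, inA_iff hw']
    exact h
  · rw [e, inA_iff (red_cons_cons.2 ⟨by omega, red_singleton _⟩)]
    exact h
  · rw [e]
    exact inA_one hl

lemma inB_mul_quot {n : ℕ} {m l : ℤ} (hm : 0 < m) (hl : 1 ≤ l) {f : FreeGroup ℤ} (hf : f ∈ Fn n)
    (h : InB l f) : InB l (f * (x 0 * (x m)⁻¹)) := by
  by_cases hf1 : f = 1
  · subst hf1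
    exact absurd h (not_inB_one hl)
  obtain ⟨b, c, w, hw, rfl⟩ := exists_cons_nf hf hf1
  rw [inB_iff hw.red] at h
  have he : Even w.length := by simpa [Nat.even_add_one] using hw.even
  rcases ev_mul_quot hm.ne' hw.red he with ⟨w', hw', e, -⟩ | ⟨hc, hw0, hb, e⟩ | ⟨-, hc, -, e⟩
  · rw [e, inB_iff hw']
    exact h
  · omega
  · omega

/-- The base arc. -/
def t : FreeGroup ℤ := x 0 * (x 1)⁻¹

lemma t_mem (n : ℕ) : t ∈ Fn n := x_mul_x_inv_mem (by omega) (by omega) (by omega) (by omega)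

lemma not_inA_and_inB {l : ℤ} {f : FreeGroup ℤ} (h : InA l f) (h' : InB l f) : False := by
  rw [InA] at h
  linarith [h'.1]

lemma not_arc_t {n : ℕ} {l : ℤ} (hl : 1 ≤ l) : ¬ Arc n l t := by
  rintro ⟨f, hf, ⟨h1, h2⟩ | ⟨h1, h2⟩⟩
  · exact not_inA_and_inB (inA_mul_quot one_pos hl hf h1) h2
  · exact not_inA_and_inB h1 (inB_mul_quot one_pos hl hf h2)

/-- The boundary element. -/
def bdry (n : ℕ) : FreeGroup ℤ := x (n + 1) * (x 0)⁻¹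

lemma bdry_mem (n : ℕ) : bdry n ∈ Fn n :=
  x_mul_x_inv_mem (by omega) (by omega) (by omega) (by omega)

lemma arc_conj {n : ℕ} {l : ℤ} (hl : 1 ≤ l) {α : FreeGroup ℤ} (hα : α ∈ Fn n) (h : Arc n l α) :
    Arc n l (bdry n * α * (bdry n)⁻¹) := by
  obtain ⟨f, hf, h⟩ := h
  have e : (bdry n)⁻¹ = x 0 * (x ((n : ℤ) + 1))⁻¹ := by simp [bdry]
  have e2 : f * (bdry n)⁻¹ * (bdry n * α * (bdry n)⁻¹) = f * α * (bdry n)⁻¹ := by group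
  refine ⟨f * (bdry n)⁻¹, (Fn n).mul_mem hf ((Fn n).inv_mem (bdry_mem n)), ?_⟩
  rw [e2, e]
  have hm : (0 : ℤ) < (n : ℤ) + 1 := by omega
  have hfα := (Fn n).mul_mem hf hα
  exact h.imp (fun h => ⟨inA_mul_quot hm hl hf h.1, inB_mul_quot hm hl hfα h.2⟩)
    (fun h => ⟨inA_mul_quot hm hl hfα h.1, inB_mul_quot hm hl hf h.2⟩)

/-- Words with equal heads compare as their tails, on the same side of the head. -/
lemma pt_cons_lt {b c d : ℤ} {u v : List ℤ} (hu : Red (b :: c :: u)) (hv : Red (b :: d :: v))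
    (hs : (c < -b ∧ d < -b) ∨ (-b < c ∧ -b < d)) (h : pt (ev (c :: u)) < pt (ev (d :: v))) :
    pt (ev (b :: c :: u)) < pt (ev (b :: d :: v)) := by
  obtain ⟨e1, a1, a2⟩ := pt_ev_cons_cons hu
  obtain ⟨e2, b1, b2⟩ := pt_ev_cons_cons hv
  rw [e1, e2]
  rcases hs with ⟨h1, h2⟩ | ⟨h1, h2⟩
  · have := one_div_lt_one_div_of_neg_of_lt (by linarith [b1 h2] : pt (ev (d :: v)) + 2 * (b : ℚ) < 0)
      (by linarith : pt (ev (c :: u)) + 2 * (b : ℚ) < pt (ev (d :: v)) + 2 * b)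
    linarith
  · have := one_div_lt_one_div_of_lt (by linarith [a2 h1] : 0 < pt (ev (c :: u)) + 2 * (b : ℚ))
      (by linarith : pt (ev (c :: u)) + 2 * (b : ℚ) < pt (ev (d :: v)) + 2 * b)
    linarith

lemma pt_singleton (b : ℤ) : pt (ev [b]) = 2 * b := (pt_T_one b).2

/-- Words with equal heads compare by their second letters on the same side of the head. -/
lemma pt_lt_of_second {b c d : ℤ} {u v : List ℤ} (hu : Red (b :: c :: u)) (hv : Red (b :: d :: v))
    (hs : (c < d ∧ (d < -b ∨ -b < c)) ∨ (d < -b ∧ -b < c)) :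
    pt (ev (b :: c :: u)) < pt (ev (b :: d :: v)) := by
  rcases hs with ⟨h, h'⟩ | ⟨h1, h2⟩
  · exact pt_cons_lt hu hv (by omega) (pt_lt_of_head_lt hu.tail hv.tail h)
  · exact (pt_lt_of_second_gt hu h2).trans (pt_gt_of_second_lt hv h1)

lemma pt_lt_third_nil {a b c : ℤ} {u : List ℤ} (hu : Red (a :: b :: c :: u)) (h : -b < c) :
    pt (ev (a :: b :: c :: u)) < pt (ev [a, b]) := by
  have := (red_cons_cons.1 hu).1
  refine pt_cons_lt hu (red_cons_cons.2 ⟨this, red_singleton b⟩) (by omega) ?_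
  rw [pt_singleton]
  exact pt_lt_of_second_gt hu.tail h

lemma pt_nil_lt_third {a b c : ℤ} {u : List ℤ} (hu : Red (a :: b :: c :: u)) (h : c < -b) :
    pt (ev [a, b]) < pt (ev (a :: b :: c :: u)) := by
  have := (red_cons_cons.1 hu).1
  refine pt_cons_lt (red_cons_cons.2 ⟨this, red_singleton b⟩) hu (by omega) ?_
  rw [pt_singleton]
  exact pt_gt_of_second_lt hu.tail h

/-- The automorphisms of the free group that act on `Fn n` preserving the order of the points. -/
def orderAut (n : ℕ) : Subgroup (MulAut (FreeGroup ℤ)) where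
  carrier := {φ | (∀ f, φ f ∈ Fn n ↔ f ∈ Fn n) ∧ (∀ f ∈ Fn n, ∀ g ∈ Fn n, f ≠ 1 → g ≠ 1 →
    (pt (φ f) < pt (φ g) ↔ pt f < pt g)) ∧ φ (bdry n) = bdry n}
  one_mem' := ⟨fun _ => Iff.rfl, fun _ _ _ _ _ _ => Iff.rfl, rfl⟩
  mul_mem' := by
    rintro φ ψ ⟨h1, h2, h3⟩ ⟨h1', h2', h3'⟩
    refine ⟨fun f => (h1 _).trans (h1' _), fun f hf g hg hf1 hg1 => ?_, ?_⟩
    · rw [MulAut.mul_apply, MulAut.mul_apply, h2 _ ((h1' _).2 hf) _ ((h1' _).2 hg) (by simpa)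
        (by simpa), h2' _ hf _ hg hf1 hg1]
    · rw [MulAut.mul_apply, h3', h3]
  inv_mem' := by
    rintro φ ⟨h1, h2, h3⟩
    have h4 : ∀ f, φ⁻¹ f ∈ Fn n ↔ f ∈ Fn n := fun f => by
      rw [← h1, MulAut.apply_inv_self]
    refine ⟨h4, fun f hf g hg hf1 hg1 => ?_, ?_⟩
    · rw [← h2 _ ((h4 _).2 hf) _ ((h4 _).2 hg) (by simpa) (by simpa), MulAut.apply_inv_self,
        MulAut.apply_inv_self]
    · nth_rewrite 1 [← h3]
      rw [MulAut.inv_apply_self]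

lemma tau_bdry {n : ℕ} {i : ℤ} (h1 : 1 ≤ i) (h2 : i ≤ n) : tau i (bdry n) = bdry n := by
  rw [bdry, map_mul, map_inv, tau_x_ne (by omega), tau_x_ne (by omega)]

lemma tau_mem_orderAut {n : ℕ} {i : ℤ} (h1 : 1 ≤ i) (h2 : i ≤ n) : tau i ∈ orderAut n := by
  refine ⟨fun f => ⟨fun h => ?_, tau_mem h1 h2⟩, fun f hf g hg hf1 hg1 =>
    pt_tau_lt_iff i hf hg hf1 hg1, tau_bdry h1 h2⟩
  have := tau_inv_mem h1 h2 h
  rwa [MulAut.inv_apply_self] at this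

/-- The invariant properties of the images of the base arc. -/
structure Curve (n : ℕ) (α : FreeGroup ℤ) : Prop where
  mem : α ∈ Fn n
  ne_one : α ≠ 1
  not_up : ∀ f ∈ Fn n, f ≠ 1 → f * α ≠ 1 → pt f < pt α → ¬ pt α < pt (f * α)
  not_down : ∀ f ∈ Fn n, f ≠ 1 → f * α ≠ 1 → pt (f * α) < pt α → ¬ pt α < pt f
  lt_inv : pt α < pt α⁻¹

lemma Curve.map {n : ℕ} {α : FreeGroup ℤ} (h : Curve n α) {φ : MulAut (FreeGroup ℤ)}
    (hφ : φ ∈ orderAut n) : Curve n (φ α) := by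
  obtain ⟨h1, h2, h3⟩ := hφ
  have hα : φ α ≠ 1 := by simpa using h.ne_one
  have key : ∀ f ∈ Fn n, f ≠ 1 → f * φ α ≠ 1 → ∃ g ∈ Fn n, g ≠ 1 ∧ g * α ≠ 1 ∧ φ g = f ∧
      φ (g * α) = f * φ α := by
    intro f hf hf1 hf2
    have e : φ (φ⁻¹ f) = f := MulAut.apply_inv_self _ _ _
    refine ⟨φ⁻¹ f, by rwa [← h1, e], by simpa using hf1, fun h' => hf2 ?_, e, by rw [map_mul, e]⟩
    rw [← e, ← map_mul, h', map_one]
  have hm := h.mem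
  refine ⟨(h1 _).2 h.mem, hα, fun f hf hf1 hf2 => ?_, fun f hf hf1 hf2 => ?_, ?_⟩
  · obtain ⟨g, hg, hg1, hg2, rfl, e⟩ := key f hf hf1 hf2
    rw [← e, h2 _ hg _ hm hg1 h.ne_one, h2 _ hm _ (mul_mem hg hm) h.ne_one hg2]
    exact h.not_up g hg hg1 hg2
  · obtain ⟨g, hg, hg1, hg2, rfl, e⟩ := key f hf hf1 hf2
    rw [← e, h2 _ (mul_mem hg hm) _ hm hg2 h.ne_one, h2 _ hm _ hg h.ne_one hg1]
    exact h.not_down g hg hg1 hg2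
  · rw [← map_inv, h2 _ hm _ (inv_mem hm) h.ne_one (by simpa using h.ne_one)]
    exact h.lt_inv

lemma t_eq : t = ev [0, -1] := (ev_pair 0 1).symm

lemma red_t : Red [0, -1] := red_cons_cons.2 ⟨by norm_num, red_singleton _⟩

lemma below_t {b c : ℤ} {w : List ℤ} (h : Red (b :: c :: w)) (hlt : pt (ev (b :: c :: w)) < pt t) :
    b < 0 ∨ (b = 0 ∧ (c ≠ -1 ∨ ∃ d, w.head? = some d ∧ 1 < d)) := by
  by_contra! hcon
  rw [t_eq] at hlt
  refine absurd hlt (not_lt.2 ?_)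
  rcases hcon.1.lt_or_eq with hb | rfl
  · exact (pt_lt_of_head_lt red_t h hb).le
  obtain ⟨rfl, h2⟩ := hcon.2 rfl
  cases w with
  | nil => exact le_rfl
  | cons d w =>
    have h3 := h2 d rfl
    have h4 := (red_cons_cons.1 h.tail).1
    exact (pt_nil_lt_third h (by omega)).le

lemma above_t {b c : ℤ} {w : List ℤ} (h : Red (b :: c :: w)) (hlt : pt t < pt (ev (b :: c :: w))) :
    0 < b ∨ (b = 0 ∧ c = -1 ∧ ∃ d, w.head? = some d ∧ d < 1) := by
  by_contra! hcon
  rw [t_eq] at hlt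
  refine absurd hlt (not_lt.2 ?_)
  rcases hcon.1.lt_or_eq with hb | rfl
  · exact (pt_lt_of_head_lt h red_t hb).le
  have h0 := (red_cons_cons.1 h).1
  by_cases hc : c = -1
  · subst hc
    cases w with
    | nil => exact le_rfl
    | cons d w =>
      have h3 := hcon.2 rfl rfl d rfl
      have h4 := (red_cons_cons.1 h.tail).1
      exact (pt_lt_third_nil h (by omega)).le
  · exact (pt_lt_of_second h red_t (by omega)).le

lemma curve_t (n : ℕ) : Curve n t := by
  have e : ∀ f, f * t = f * (x 0 * (x 1)⁻¹) := fun _ => rfl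
  have key : ∀ f ∈ Fn n, f ≠ 1 → f * t ≠ 1 →
      ∃ b c w b' c' w', Red (b :: c :: w) ∧ f = ev (b :: c :: w) ∧ Red (b' :: c' :: w') ∧
      f * t = ev (b' :: c' :: w') ∧ ((b = b' ∧ b ≠ 0) ∨
      (b = b' ∧ c = c' ∧ (w.head? = w'.head? ∨ w = [] ∨ w' = []))) := by
    intro f hf hf1 hf2
    obtain ⟨b, c, w, hw, rfl⟩ := exists_cons_nf hf hf1
    have he : Even w.length := by simpa [Nat.even_add_one] using hw.even
    rcases ev_mul_quot one_ne_zero hw.red he with ⟨w', hw', e, h3⟩ | ⟨hc, hw0, hb, e⟩ | ⟨-, -, -, e⟩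
    · exact ⟨b, c, w, b, c, w', hw.red, rfl, hw', e, .inr ⟨rfl, rfl, h3⟩⟩
    · have := (red_cons_cons.1 hw.red).1
      exact ⟨b, c, w, b, -1, [], hw.red, rfl, red_cons_cons.2 ⟨by omega, red_singleton _⟩, e,
        .inl ⟨rfl, by omega⟩⟩
    · exact absurd e hf2
  have hval : pt t = 1 / 2 := by
    rw [t_eq, (pt_ev_cons_cons red_t).1, pt_singleton]
    norm_num
  have hne : t ≠ 1 := fun h => by
    rw [h, pt_one] at hval
    norm_num at hval
  refine ⟨t_mem n, hne, fun f hf hf1 hf2 h1 h2 => ?_, fun f hf hf1 hf2 h1 h2 => ?_, ?_⟩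
  · obtain ⟨b, c, w, b', c', w', hw, rfl, hw', e', h⟩ := key f hf hf1 hf2
    rw [e'] at h2
    have h1 := below_t hw h1
    have h2 := above_t hw' h2
    rcases h with ⟨rfl, h⟩ | ⟨rfl, rfl, h | rfl | rfl⟩
    · omega
    · rw [h] at h1
      rcases h2 with h2 | ⟨rfl, rfl, d, hd, hd1⟩
      · omega
      · rw [hd] at h1
        simp at h1
        omega
    · simp at h1
      omega
    · simp at h2
      omega
  · obtain ⟨b, c, w, b', c', w', hw, rfl, hw', e', h⟩ := key f hf hf1 hf2
    rw [e'] at h1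
    have h1 := below_t hw' h1
    have h2 := above_t hw h2
    rcases h with ⟨rfl, h⟩ | ⟨rfl, rfl, h | rfl | rfl⟩
    · omega
    · rw [← h] at h1
      rcases h2 with h2 | ⟨rfl, rfl, d, hd, hd1⟩
      · omega
      · rw [hd] at h1
        simp at h1
        omega
    · simp at h2
      omega
    · simp at h1
      omega
  · have e1 : t⁻¹ = ev [1, 0] := by
      have := ev_pair 1 0
      simp only [neg_zero] at this
      rw [this, t, mul_inv_rev, inv_inv]
    rw [t_eq] at e1 ⊢
    rw [e1]
    exact pt_lt_of_head_lt red_t (red_cons_cons.2 ⟨by norm_num, red_singleton _⟩) one_pos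

lemma ev_cons_cons (b c : ℤ) (w : List ℤ) : ev (b :: c :: w) = x b * (x (-c))⁻¹ * ev w := by
  rw [x_mul_x_inv_mul, neg_neg, ev_cons, ev_cons]

lemma nf_nil (n : ℕ) : NF n [] := ⟨red_nil, trivial, by simp⟩

lemma nf_cons_cons {n : ℕ} {b c : ℤ} {w : List ℤ} :
    NF n (b :: c :: w) ↔ (0 ≤ b ∧ b ≤ n + 1 ∧ -(n + 1) ≤ c ∧ c ≤ 0 ∧ c ≠ -b ∧
      ∀ d ∈ w.head?, d ≠ -c) ∧ NF n w := by
  constructor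
  · rintro ⟨h1, ⟨h2, h3, h4, h5, h6⟩, h7⟩
    obtain ⟨h8, h9⟩ := red_cons_cons.1 h1
    refine ⟨⟨h2, h3, h4, by simpa using h5, h8, fun d hd => ?_⟩, h9.tail, by simpa using h6,
      by simpa [Nat.even_add_one] using h7⟩
    cases w with
    | nil => simp at hd
    | cons e w =>
      obtain rfl : e = d := by simpa using hd
      exact (red_cons_cons.1 h9).1
  · rintro ⟨⟨h2, h3, h4, h5, h8, h9⟩, h1, h6, h7⟩
    refine ⟨red_cons_cons.2 ⟨h8, ?_⟩, ⟨h2, h3, h4, by simpa using h5, by simpa using h6⟩,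
      by simpa [Nat.even_add_one] using h7⟩
    cases w with
    | nil => exact red_singleton c
    | cons e w => exact red_cons_cons.2 ⟨h9 e rfl, h1⟩

lemma NF.cases {n : ℕ} {w : List ℤ} (h : NF n w) : w = [] ∨ ∃ b c v, w = b :: c :: v := by
  match w, h with
  | [], _ => exact .inl rfl
  | [b], h => exact absurd h.even (by simp)
  | b :: c :: v, _ => exact .inr ⟨b, c, v, rfl⟩

lemma NF.mem {n : ℕ} {w : List ℤ} (h : NF n w) : ev w ∈ Fn n := by
  induction hl : w.length using Nat.strong_induction_on generalizing w with
  | _ m ih =>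
    rcases h.cases with rfl | ⟨b, c, v, rfl⟩
    · exact one_mem _
    · obtain ⟨⟨h1, h2, h3, h4, -, -⟩, hv⟩ := nf_cons_cons.1 h
      rw [ev_cons_cons]
      exact mul_mem (x_mul_x_inv_mem h1 h2 (by omega) (by omega))
        (ih v.length (by simp [← hl]) hv rfl)

lemma ev_ne_one {b c : ℤ} {w : List ℤ} (h : Red (b :: c :: w)) : ev (b :: c :: w) ≠ 1 :=
  fun h' => by
    have := ev_injective h red_nil (h'.trans ev_nil.symm)
    simp at this

/-- Moving the first two letters of `v` to `r`. -/
lemma ev_move {α : FreeGroup ℤ} {c d : ℤ} {r v : List ℤ} (h : ev r * α = ev (c :: d :: v)) :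
    ev (-d :: -c :: r) * α = ev v := by
  rw [ev_cons_cons, mul_assoc, h, ev_cons_cons]
  group

lemma nf_move {n : ℕ} {c d : ℤ} {r v : List ℤ} (hr : NF n r) (hv : NF n (c :: d :: v))
    (hrc : ∀ e ∈ r.head?, c ≠ e) : NF n (-d :: -c :: r) := by
  obtain ⟨⟨h1, h2, h3, h4, h5, -⟩, -⟩ := nf_cons_cons.1 hv
  exact nf_cons_cons.2 ⟨⟨by omega, by omega, by omega, by omega, by omega,
    fun e he => by rw [neg_neg]; exact (hrc e he).symm⟩, hr⟩

lemma le_of_pt_le {b c : ℤ} {u v : List ℤ} (hu : Red (b :: u)) (hv : Red (c :: v))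
    (h : pt (ev (b :: u)) ≤ pt (ev (c :: v))) : b ≤ c := by
  by_contra! h'
  exact absurd h (not_le.2 (pt_lt_of_head_lt hv hu h'))

lemma pt_nil_le {n : ℕ} {a : ℤ} {w : List ℤ} (h : NF n (a :: -(n + 1) :: w)) :
    pt (ev [a, -((n : ℤ) + 1)]) ≤ pt (ev (a :: -(n + 1) :: w)) := by
  obtain ⟨⟨h1, h2, h3, h4, h5, h6⟩, hw⟩ := nf_cons_cons.1 h
  rcases hw.cases with rfl | ⟨d, d', w, rfl⟩
  · exact le_rfl
  · have := h6 d rfl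
    have := (nf_cons_cons.1 hw).1
    exact (pt_nil_lt_third h.red (by omega)).le

lemma Curve.one_le_head {n : ℕ} {b c : ℤ} {w : List ℤ} (hw : NF n (b :: c :: w))
    (hα : Curve n (ev (b :: c :: w))) (h1 : pt t < pt (ev (b :: c :: w))) : 1 ≤ b := by
  by_contra! hb
  rcases above_t hw.red h1 with h | ⟨rfl, rfl, d, hd, hd1⟩
  · omega
  obtain ⟨-, hw'⟩ := nf_cons_cons.1 hw
  rcases hw'.cases with rfl | ⟨d', c', v, rfl⟩
  · simp at hd
  obtain rfl : d' = d := by simpa using hd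
  have hd0 := (nf_cons_cons.1 hw').1
  have e : ev [1, 0] * ev (0 :: -1 :: d' :: c' :: v) = ev (d' :: c' :: v) := by
    rw [ev_cons_cons 1, ev_cons_cons 0, ev_nil]
    simp [mul_assoc]
  obtain rfl : d' = 0 := by omega
  have hr : NF n [1, 0] := nf_cons_cons.2 ⟨⟨by omega, by omega, by omega, by omega, by omega,
    by simp⟩, nf_nil n⟩
  refine hα.not_down _ hr.mem (ev_ne_one hr.red) ?_ ?_
    (pt_lt_of_head_lt hw.red hr.red one_pos)
  · rw [e]
    exact ev_ne_one hw'.red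
  · rw [e, (pt_ev_cons_cons hw.red).1, (pt_ev_cons_cons hw.red.tail).1]
    have h2 := (ping_pong hw'.red).2.2
    set z := pt (ev (0 :: c' :: v))
    have h3 : z < 1 := by simpa using h2
    have h4 : z - 2 ≠ 0 := by linarith
    have h5 : 3 - 2 * z ≠ 0 := by linarith
    have h6 : 2 * (z - 2) + 1 ≠ 0 := fun h => h5 (by linarith)
    have : 2 * ((0 : ℤ) : ℚ) - 1 / (2 * ((-1 : ℤ) : ℚ) - 1 / (z + 2 * ((-1 : ℤ) : ℚ)) +
        2 * ((0 : ℤ) : ℚ)) - z = 2 * (z - 1) ^ 2 / (3 - 2 * z) := by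
      have e1 : 2 * ((-1 : ℤ) : ℚ) - 1 / (z + 2 * ((-1 : ℤ) : ℚ)) + 2 * ((0 : ℤ) : ℚ) =
          (3 - 2 * z) / (z - 2) := by
        push_cast
        rw [show z + 2 * (-1) = z - 2 by ring]
        field_simp
        ring
      rw [e1]
      push_cast
      field_simp
      ring
    have h7 : 0 < 2 * (z - 1) ^ 2 / (3 - 2 * z) :=
      div_pos (by have : z - 1 ≠ 0 := by linarith
                  positivity) (by linarith)
    linarith

/-- A curve between the base arc and the last arc admits an arc of index at most `n - 1`. -/
lemma exists_arc_low {n : ℕ} {α : FreeGroup ℤ} (hα : Curve n α) (h1 : pt t < pt α)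
    (h2 : pt α < pt (ev [(n : ℤ), -((n : ℤ) + 1)])) : ∃ l : ℤ, 1 ≤ l ∧ l < n ∧ Arc n l α := by
  obtain ⟨b₁, b₂, w, hw, rfl⟩ := exists_cons_nf hα.mem hα.ne_one
  have hb1 : 1 ≤ b₁ := hα.one_le_head hw h1
  have hu : Red [(n : ℤ), -((n : ℤ) + 1)] := red_cons_cons.2 ⟨by omega, red_singleton _⟩
  have hbn : b₁ ≤ n := le_of_pt_le hw.red hu h2.le
  set α := ev (b₁ :: b₂ :: w) with hαd
  suffices loop : ∀ (m : ℕ) (r v : List ℤ), v.length = m → NF n r → NF n v → ev r * α = ev v →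
      (r = [] ∨ ∃ e e' r', r = e :: e' :: r' ∧ e' < -e ∧ -e' ≤ b₁) →
      (∀ c ∈ v.head?, ∀ e ∈ r.head?, c ≠ e) → ∃ l : ℤ, 1 ≤ l ∧ l < n ∧ Arc n l α by
    exact loop _ [] _ rfl (nf_nil n) hw (by rw [ev_nil, one_mul]) (.inl rfl) (by simp)
  intro m
  induction m using Nat.strong_induction_on with
  | _ m ih =>
    intro r v hm hr hv e hinv hne
    rcases hv.cases with rfl | ⟨c, d, v', rfl⟩
    · exfalso
      rcases hinv with rfl | ⟨e₁, e₂, r', rfl, h3, h4⟩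
      · exact hα.ne_one (by simpa using e)
      · have h5 := hα.lt_inv
        rw [← eq_inv_of_mul_eq_one_left e] at h5
        have := le_of_pt_le hw.red hr.red h5.le
        omega
    obtain ⟨⟨k1, k2, k3, k4, k5, k6⟩, hv'⟩ := nf_cons_cons.1 hv
    have hle : pt (ev (c :: d :: v')) ≤ pt α := by
      rcases hinv with rfl | ⟨e₁, e₂, r', rfl, h3, h4⟩
      · rw [← e, ev_nil, one_mul]
      · have h5 : pt (ev (e₁ :: e₂ :: r')) < pt α := pt_lt_of_head_lt hr.red hw.red (by omega)
        have := hα.not_up _ hr.mem (ev_ne_one hr.red) (by rw [e]; exact ev_ne_one hv.red) h5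
        rwa [e, not_lt] at this
    have hcb : c ≤ b₁ := le_of_pt_le hv.red hw.red hle
    by_cases hd : d < -c
    · have hcn : c < n := by
        by_contra! hcn
        obtain rfl : c = n := by omega
        obtain rfl : d = -(n + 1) := by omega
        exact absurd (pt_nil_le hv) (not_le.2 (hle.trans_lt h2))
      have hB : InB c (ev r * α) := by
        rw [e]
        exact (inB_iff hv.red).2 ⟨rfl, hd⟩
      rcases hinv with rfl | ⟨e₁, e₂, r', rfl, h3, h4⟩
      · have : c :: d :: v' = b₁ :: b₂ :: w :=
          ev_injective hv.red hw.red (by rw [← e, ev_nil, one_mul])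
        have hc1 : 1 ≤ c := by
          have : c = b₁ := by simpa using congrArg List.head? this
          omega
        exact ⟨c, hc1, hcn, _, hr.mem, .inl ⟨inA_one hc1, hB⟩⟩
      · have h6 : c ≠ e₁ := hne c rfl e₁ rfl
        have h7 := (nf_cons_cons.1 hr).1
        rcases lt_or_gt_of_ne h6 with h8 | h8
        · refine ⟨e₁, by omega, by omega, _, hr.mem, .inr ⟨?_, (inB_iff hr.red).2 ⟨rfl, h3⟩⟩⟩
          rw [e]
          exact (inA_iff hv.red).2 h8
        · exact ⟨c, by omega, hcn, _, hr.mem, .inl ⟨(inA_iff hr.red).2 h8, hB⟩⟩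
    · have hrec : ∃ l : ℤ, 1 ≤ l ∧ l < n ∧ Arc n l α :=
        ih v'.length (by simp [← hm]) (-d :: -c :: r) v' rfl
          (nf_move hr hv (fun e he => hne c rfl e he)) hv' (ev_move e)
          (.inr ⟨-d, -c, r, rfl, by omega, by omega⟩)
          (fun c' hc' e he => by
            obtain rfl : -d = e := by simpa using he
            exact k6 c' hc')
      exact hrec

/-- A curve between the last arc and its full twist admits an arc of index at least `2`. -/
lemma exists_arc_high {n : ℕ} (hn : 2 ≤ n) {α : FreeGroup ℤ} (hα : Curve n α)
    (h1 : pt (ev [(n : ℤ), -((n : ℤ) + 1)]) ≤ pt α)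
    (h2 : pt α < pt (ev [(n : ℤ) + 1, -1, 0, -((n : ℤ) + 1)])) :
    ∃ l : ℤ, 2 ≤ l ∧ l ≤ n ∧ Arc n l α := by
  obtain ⟨b₁, b₂, w, hw, rfl⟩ := exists_cons_nf hα.mem hα.ne_one
  have hu : Red [(n : ℤ), -((n : ℤ) + 1)] := red_cons_cons.2 ⟨by omega, red_singleton _⟩
  have hΔ : NF n [(n : ℤ) + 1, -1, 0, -((n : ℤ) + 1)] := by
    refine nf_cons_cons.2 ⟨⟨by omega, by omega, by omega, by omega, by omega, by simp⟩,
      nf_cons_cons.2 ⟨⟨by omega, by omega, by omega, by omega, by omega, by simp⟩, nf_nil n⟩⟩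
  have hbn : (n : ℤ) ≤ b₁ := le_of_pt_le hu hw.red h1
  obtain ⟨⟨k1, k2, k3, k4, k5, k6⟩, hw'⟩ := nf_cons_cons.1 hw
  rcases hbn.eq_or_lt with rfl | hb
  · refine ⟨n, by omega, le_rfl, 1, one_mem _, .inl ⟨inA_one (by omega), ?_⟩⟩
    rw [one_mul]
    refine (inB_iff hw.red).2 ⟨rfl, ?_⟩
    by_contra! h3
    have h4 := pt_lt_of_second_gt hw.red (by omega)
    have h5 := pt_gt_of_second_lt hu (by omega)
    linarith
  obtain rfl : b₁ = n + 1 := by omega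
  have hbig : ∀ d v, NF n ((n + 1 : ℤ) :: -1 :: 0 :: d :: v) →
      pt (ev [(n : ℤ) + 1, -1, 0, -((n : ℤ) + 1)]) ≤ pt (ev ((n + 1 : ℤ) :: -1 :: 0 :: d :: v)) := by
    intro d v h
    have h' := (nf_cons_cons.1 h).2
    have h'' := (nf_cons_cons.1 h').1
    have lift : ∀ {u v : List ℤ}, Red ((n + 1 : ℤ) :: -1 :: 0 :: u) →
        Red ((n + 1 : ℤ) :: -1 :: 0 :: v) → pt (ev (0 :: u)) < pt (ev (0 :: v)) →
        pt (ev ((n + 1 : ℤ) :: -1 :: 0 :: u)) < pt (ev ((n + 1 : ℤ) :: -1 :: 0 :: v)) :=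
      fun hu hv h => pt_cons_lt hu hv (by omega) (pt_cons_lt hu.tail hv.tail (by omega) h)
    by_cases hd : d = -(n + 1)
    · subst hd
      rcases (pt_nil_le h').eq_or_lt with h3 | h3
      · have h4 := pt_injective ((nf_cons_cons.1 hΔ).2).mem h'.mem
          (ev_ne_one ((nf_cons_cons.1 hΔ).2).red) (ev_ne_one h'.red) h3
        have h5 := ev_injective ((nf_cons_cons.1 hΔ).2).red h'.red h4
        rw [← h5]
      · exact (lift hΔ.red h.red h3).le
    · exact (lift hΔ.red h.red (pt_lt_of_second hΔ.red.tail.tail h'.red (by omega))).le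
  have hb2 : b₂ ≤ -1 := by
    by_contra! h3
    exact absurd h2 (not_lt.2 (pt_lt_of_second hΔ.red hw.red (by omega)).le)
  set α := ev ((n + 1 : ℤ) :: b₂ :: w) with hαd
  suffices loop : ∀ (m : ℕ) (r v : List ℤ), v.length = m → NF n r → NF n v → ev r * α = ev v →
      (∃ e e' r', r = e :: e' :: r' ∧ e' < -e ∧ -b₂ ≤ e) →
      (∀ c ∈ v.head?, ∀ e ∈ r.head?, c ≠ e) → ∃ l : ℤ, 2 ≤ l ∧ l ≤ n ∧ Arc n l α by
    refine loop _ (-b₂ :: -(n + 1) :: []) w rfl (nf_move (nf_nil n) hw (by simp)) hw'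
      (ev_move (by rw [ev_nil, one_mul])) ⟨_, _, _, rfl, by omega, le_rfl⟩ ?_
    intro c hc e he
    obtain rfl : -b₂ = e := by simpa using he
    exact k6 c hc
  intro m
  induction m using Nat.strong_induction_on with
  | _ m ih =>
    rintro r v hm hr hv e ⟨e₁, e₂, r', rfl, h3, h4⟩ hne
    obtain ⟨⟨q1, q2, q3, q4, q5, q6⟩, hr'⟩ := nf_cons_cons.1 hr
    rcases hv.cases with rfl | ⟨c, d, v', rfl⟩
    · exfalso
      have h5 := hα.lt_inv
      rw [← eq_inv_of_mul_eq_one_left e] at h5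
      have := le_of_pt_le hw.red hr.red h5.le
      omega
    obtain ⟨⟨p1, p2, p3, p4, p5, p6⟩, hv'⟩ := nf_cons_cons.1 hv
    have hce : c ≠ e₁ := hne c rfl e₁ rfl
    rcases lt_or_gt_of_ne hce with h5 | h5
    · have he2 : 2 ≤ e₁ := by
        by_contra! he
        obtain rfl : e₁ = 1 := by omega
        obtain rfl : c = 0 := by omega
        obtain rfl : b₂ = -1 := by omega
        have hN : NF n ((n + 1 : ℤ) :: -1 :: 0 :: d :: v') :=
          nf_cons_cons.2 ⟨⟨by omega, by omega, by omega, by omega, by omega, by simp⟩, hv⟩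
        have e3 : x (n + 1 : ℤ) * (x 1)⁻¹ * ev (1 :: e₂ :: r') * α =
            ev ((n + 1 : ℤ) :: -1 :: 0 :: d :: v') := by
          rw [ev_cons_cons _ (-1), neg_neg, ← e, ← mul_assoc]
        have hlt := h2.trans_le (hbig d v' hN)
        rw [← e3] at hlt
        have hm1 : x (n + 1 : ℤ) * (x 1)⁻¹ * ev (1 :: e₂ :: r') ∈ Fn n :=
          mul_mem (x_mul_x_inv_mem (by omega) (by omega) (by omega) (by omega)) hr.mem
        have e4 : x (n + 1 : ℤ) * (x 1)⁻¹ * ev (1 :: e₂ :: r') =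
            x (n + 1 : ℤ) * (x (-e₂))⁻¹ * ev r' := by
          rw [ev_cons_cons 1]
          group
        have hne1 : x (n + 1 : ℤ) * (x 1)⁻¹ * ev (1 :: e₂ :: r') * α ≠ 1 := by
          rw [e3]
          exact ev_ne_one hN.red
        by_cases he2 : e₂ = -(n + 1)
        · subst he2
          rw [neg_neg, mul_inv_cancel, one_mul] at e4
          rw [e4] at hm1 hne1 hlt
          rcases hr'.cases with rfl | ⟨g, g', r'', rfl⟩
          · have h6 : ev (0 :: d :: v') = ev w := by
              rw [← e, hαd, ev_cons_cons 1, ev_cons_cons _ (-1), ev_nil]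
              group
            have h7 := ev_injective hv.red hw'.red h6
            rw [← h7] at hαd
            have h8 := hbig d v' hN
            rw [← hαd] at h8
            linarith
          · have h6 := q6 g rfl
            have h7 := (nf_cons_cons.1 hr').1
            exact hα.not_up _ hm1 (ev_ne_one hr'.red) hne1
              (pt_lt_of_head_lt hr'.red hw.red (by omega)) hlt
        · have hN' : NF n ((n + 1 : ℤ) :: e₂ :: r') :=
            nf_cons_cons.2 ⟨⟨by omega, by omega, by omega, by omega, by omega, q6⟩, hr'⟩
          rw [e4, ← ev_cons_cons] at hm1 hne1 hlt
          exact hα.not_up _ hm1 (ev_ne_one hN'.red) hne1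
            (pt_lt_of_second hN'.red hw.red (by omega)) hlt
      refine ⟨e₁, he2, by omega, _, hr.mem, .inr ⟨?_, (inB_iff hr.red).2 ⟨rfl, h3⟩⟩⟩
      rw [e]
      exact (inA_iff hv.red).2 h5
    · by_cases hd : d < -c
      · refine ⟨c, by omega, by omega, _, hr.mem, .inl ⟨(inA_iff hr.red).2 h5, ?_⟩⟩
        rw [e]
        exact (inB_iff hv.red).2 ⟨rfl, hd⟩
      have hdb : -b₂ ≤ -d := by
        by_contra! hdb
        have hN : NF n ((n + 1 : ℤ) :: d :: v') :=
          nf_cons_cons.2 ⟨⟨by omega, by omega, by omega, by omega, by omega, p6⟩, hv'⟩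
        have e3 : x (n + 1 : ℤ) * (x c)⁻¹ * ev (e₁ :: e₂ :: r') * α = ev ((n + 1 : ℤ) :: d :: v') := by
          rw [mul_assoc, e, ev_cons_cons, ev_cons_cons]
          group
        have hm1 : x (n + 1 : ℤ) * (x c)⁻¹ * ev (e₁ :: e₂ :: r') ∈ Fn n :=
          mul_mem (x_mul_x_inv_mem (by omega) (by omega) (by omega) (by omega)) hr.mem
        have hne1 : x (n + 1 : ℤ) * (x c)⁻¹ * ev (e₁ :: e₂ :: r') * α ≠ 1 := by
          rw [e3]
          exact ev_ne_one hN.red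
        have hlt : pt α < pt (x (n + 1 : ℤ) * (x c)⁻¹ * ev (e₁ :: e₂ :: r') * α) := by
          rw [e3]
          exact pt_lt_of_second hw.red hN.red (by omega)
        by_cases hc : c = n + 1
        · subst hc
          rw [mul_inv_cancel, one_mul] at hm1 hne1 hlt
          exact hα.not_up _ hm1 (ev_ne_one hr.red) hne1
            (pt_lt_of_head_lt hr.red hw.red (by omega)) hlt
        · have hN' : NF n ((n + 1 : ℤ) :: -c :: e₁ :: e₂ :: r') :=
            nf_cons_cons.2 ⟨⟨by omega, by omega, by omega, by omega, by omega, by simp; omega⟩, hr⟩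
          have e4 : x (n + 1 : ℤ) * (x c)⁻¹ * ev (e₁ :: e₂ :: r') =
              ev ((n + 1 : ℤ) :: -c :: e₁ :: e₂ :: r') := by rw [ev_cons_cons _ (-c), neg_neg]
          rw [e4] at hm1 hne1 hlt
          exact hα.not_up _ hm1 (ev_ne_one hN'.red) hne1
            (pt_lt_of_second hN'.red hw.red (by omega)) hlt
      have hrec : ∃ l : ℤ, 2 ≤ l ∧ l ≤ n ∧ Arc n l α :=
        ih v'.length (by simp [← hm]) (-d :: -c :: e₁ :: e₂ :: r') v' rfl
          (nf_move hr hv (fun e he => hne c rfl e he)) hv' (ev_move e)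
          ⟨-d, -c, _, rfl, by omega, hdb⟩
          (fun c' hc' e he => by
            obtain rfl : -d = e := by simpa using he
            exact p6 c' hc')
      exact hrec

open GarsideOrder BraidOrder

section Algebra

variable {n : ℕ}

lemma gen_eq {i : ℕ} (h : i < n) : gen n i = PresentedGroup.of ⟨i, h⟩ := dif_pos h

lemma gen_braid {i : ℕ} (h : i + 1 < n) :
    gen n i * gen n (i + 1) * gen n i = gen n (i + 1) * gen n i * gen n (i + 1) := by
  rw [gen_eq h, gen_eq (Nat.lt_of_succ_lt h)]
  exact PresentedGroup.mk_eq_mk_of_mul_inv_mem ⟨⟨i, _⟩, ⟨i + 1, h⟩, .inl ⟨rfl, rfl⟩⟩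

lemma gen_comm {i j : ℕ} (h : i + 2 ≤ j) : gen n i * gen n j = gen n j * gen n i := by
  by_cases hj : j < n
  · rw [gen_eq hj, gen_eq (show i < n by omega)]
    exact PresentedGroup.mk_eq_mk_of_mul_inv_mem ⟨⟨i, _⟩, ⟨j, hj⟩, .inr ⟨h, rfl⟩⟩
  · rw [gen, gen, dif_neg hj, mul_one, one_mul]

/-- The homomorphism defined on the braid group by images satisfying the braid relations. -/
def braidLift {G : Type*} [Group G] (f : ℕ → G)
    (hb : ∀ i, i + 1 < n → f i * f (i + 1) * f i = f (i + 1) * f i * f (i + 1))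
    (hc : ∀ i j, i + 2 ≤ j → j < n → f i * f j = f j * f i) : Braid n →* G :=
  PresentedGroup.toGroup (f := fun i : Fin n => f i) (by
    rintro r ⟨i, j, ⟨hij, rfl⟩ | ⟨hij, rfl⟩⟩
    · simp only [map_mul, map_inv, FreeGroup.lift_apply_of, ← hij]
      exact mul_inv_eq_one.2 (hb i (hij ▸ j.2))
    · simp only [map_mul, map_inv, FreeGroup.lift_apply_of]
      exact mul_inv_eq_one.2 (hc i j hij j.2))

lemma braidLift_gen {G : Type*} [Group G] {f : ℕ → G}
    (hb : ∀ i, i + 1 < n → f i * f (i + 1) * f i = f (i + 1) * f i * f (i + 1))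
    (hc : ∀ i j, i + 2 ≤ j → j < n → f i * f j = f j * f i) {i : ℕ} (hi : i < n) :
    braidLift f hb hc (gen n i) = f i := by
  rw [gen_eq hi]
  exact PresentedGroup.toGroup.of _

lemma braid_mem_of_gen (H : Subgroup (Braid n)) (h : ∀ i < n, gen n i ∈ H) (g : Braid n) :
    g ∈ H :=
  PresentedGroup.generated_by _ H (fun j => by rw [← gen_eq j.2]; exact h j j.2) g

lemma seg_zero_zero : seg n 0 0 = 1 := by simp [seg]

lemma seg_zero_succ (k : ℕ) : seg n 0 (k + 1) = seg n 0 k * gen n k := by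
  simp [seg, List.range_succ]

lemma seg_one_one : seg n 1 1 = 1 := by simp [seg]

lemma seg_one_succ (k : ℕ) : seg n 1 (k + 2) = seg n 1 (k + 1) * gen n (k + 1) := by
  rw [seg, List.range_succ, List.drop_append_of_le_length (by simp)]
  simp [seg]

lemma segRev_zero : segRev n 0 0 = 1 := by simp [segRev]

lemma segRev_succ (k : ℕ) : segRev n 0 (k + 1) = gen n k * segRev n 0 k := by
  simp [segRev, List.range_succ]

lemma seg_eq_gen_mul (k : ℕ) : seg n 0 (k + 1) = gen n 0 * seg n 1 (k + 1) := by
  induction k with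
  | zero => rw [seg_zero_succ, seg_zero_zero, seg_one_one, one_mul, mul_one]
  | succ k ih => rw [seg_zero_succ, ih, seg_one_succ, mul_assoc]

lemma gen_mul_seg {j k : ℕ} (h : k < j) : gen n j * seg n 0 k = seg n 0 k * gen n j := by
  induction k with
  | zero => rw [seg_zero_zero, one_mul, mul_one]
  | succ k ih =>
    rw [seg_zero_succ, ← mul_assoc, ih (by omega), mul_assoc, ← gen_comm (by omega), mul_assoc]

lemma seg_mul_gen {i k : ℕ} (h : i + 2 ≤ k) (hk : k ≤ n) :
    seg n 0 k * gen n i = gen n (i + 1) * seg n 0 k := by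
  induction k, h using Nat.le_induction with
  | base =>
    rw [seg_zero_succ, seg_zero_succ, ← mul_assoc, ← mul_assoc, gen_mul_seg (by omega), mul_assoc,
      mul_assoc, ← mul_assoc (gen n i), gen_braid (by omega)]
    simp only [mul_assoc]
  | succ k h ih =>
    rw [seg_zero_succ, mul_assoc, ← gen_comm (by omega), ← mul_assoc, ih (by omega), mul_assoc]

lemma seg_pow_mul_gen {i j : ℕ} (h : i + j < n) :
    seg n 0 n ^ j * gen n i = gen n (i + j) * seg n 0 n ^ j := by
  induction j with
  | zero => simp
  | succ j ih =>
    rw [pow_succ', mul_assoc, ih (by omega), ← mul_assoc, seg_mul_gen (by omega) le_rfl, mul_assoc,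
      add_assoc]

lemma seg_mul_seg {k : ℕ} (h : k + 1 ≤ n) :
    seg n 0 n * seg n 0 k = seg n 1 (k + 1) * seg n 0 n := by
  induction k with
  | zero => rw [seg_zero_zero, seg_one_one, one_mul, mul_one]
  | succ k ih =>
    rw [seg_zero_succ, ← mul_assoc, ih (by omega), mul_assoc, seg_mul_gen (by omega) le_rfl,
      seg_one_succ, mul_assoc]

lemma seg_sq_mul_gen (k : ℕ) (h : n = k + 1) :
    seg n 0 n ^ 2 * gen n k = gen n 0 * seg n 0 n ^ 2 := by
  have h1 := seg_mul_seg (n := n) (k := k) (by omega)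
  have h2 := seg_eq_gen_mul (n := n) k
  have h3 := seg_zero_succ (n := n) k
  rw [← h] at h1 h2 h3
  have e : seg n 0 n ^ 2 = gen n 0 * (seg n 0 n * seg n 0 k) := by
    rw [h1, ← mul_assoc, ← h2, sq]
  calc seg n 0 n ^ 2 * gen n k = gen n 0 * (seg n 0 n * seg n 0 k) * gen n k := by rw [← e]
    _ = gen n 0 * (seg n 0 n * (seg n 0 k * gen n k)) := by simp only [mul_assoc]
    _ = gen n 0 * seg n 0 n ^ 2 := by rw [← h3, sq]

lemma delta_mul_gen {i : ℕ} (h : i < n) : Δb n * gen n i = gen n i * Δb n := by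
  obtain ⟨j, rfl⟩ : ∃ j, n = i + j + 1 := ⟨n - i - 1, by omega⟩
  rw [Δb, show i + j + 1 + 1 = i + (2 + j) by omega, pow_add, pow_add, mul_assoc, mul_assoc,
    seg_pow_mul_gen (by omega), ← mul_assoc (_ ^ 2), seg_sq_mul_gen _ rfl, ← mul_assoc, ← mul_assoc,
    seg_pow_mul_gen (by omega), zero_add]
  simp only [mul_assoc]

lemma delta_central (g : Braid n) : Δb n * g = g * Δb n :=
  (Subgroup.mem_centralizer_iff.1 (braid_mem_of_gen (Subgroup.centralizer {Δb n})
    (fun i hi => Subgroup.mem_centralizer_iff.2 (by rintro _ rfl; exact delta_mul_gen hi)) g)) _ rfl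

lemma delta_pow_central (p : ℕ) (g : Braid n) : Δb n ^ p * g = g * Δb n ^ p :=
  (Commute.pow_left (show Commute (Δb n) g from delta_central g) p).eq

lemma seg_mul_segRev {k : ℕ} (h : k < n) :
    seg n 0 n * segRev n 0 k = segRev n 0 (k + 1) * seg n 1 n := by
  induction k with
  | zero =>
    obtain ⟨m, rfl⟩ : ∃ m, n = m + 1 := ⟨n - 1, by omega⟩
    rw [segRev_succ, segRev_zero, mul_one, mul_one, ← seg_eq_gen_mul]
  | succ k ih =>
    rw [segRev_succ k, ← mul_assoc, seg_mul_gen (by omega) le_rfl, mul_assoc, ih (by omega),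
      segRev_succ (k + 1), mul_assoc]

lemma seg_pow_eq {k : ℕ} (h : k ≤ n) : seg n 0 n ^ k = segRev n 0 k * seg n 1 n ^ k := by
  induction k with
  | zero => rw [segRev_zero, pow_zero, pow_zero, one_mul]
  | succ k ih =>
    rw [pow_succ', ih (by omega), ← mul_assoc, seg_mul_segRev (by omega), pow_succ', mul_assoc]

lemma delta_eq : Δb n = seg n 0 n * segRev n 0 n * Δ₁b n := by
  rw [Δb, pow_succ', seg_pow_eq le_rfl, Δ₁b, mul_assoc]

lemma theta_eq : Δb n * (Δ₁b n)⁻¹ = seg n 0 n * segRev n 0 n := by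
  rw [delta_eq, mul_inv_cancel_right]

/-- The products of `k` generators. -/
inductive IsPos (n : ℕ) : ℕ → Braid n → Prop
  | one : IsPos n 0 1
  | cons {k : ℕ} {a : Braid n} (i : ℕ) (hi : i < n) (ha : IsPos n k a) : IsPos n (k + 1) (gen n i * a)

lemma IsPos.mem {k : ℕ} {a : Braid n} (h : IsPos n k a) : a ∈ Mb n := by
  induction h with
  | one => exact one_mem _
  | cons i hi _ ih => exact mul_mem (Submonoid.subset_closure ⟨i, hi, rfl⟩) ih

lemma exists_isPos {a : Braid n} (h : a ∈ Mb n) : ∃ k, IsPos n k a := by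
  induction h using Submonoid.closure_induction_left with
  | one => exact ⟨0, .one⟩
  | mul_left g hg a _ ih =>
    obtain ⟨i, hi, rfl⟩ := hg
    obtain ⟨k, hk⟩ := ih
    exact ⟨k + 1, .cons i hi hk⟩

lemma gen_mem_Mb {i : ℕ} (hi : i < n) : gen n i ∈ Mb n := Submonoid.subset_closure ⟨i, hi, rfl⟩
lemma gen_mem_M₁b {i : ℕ} (h : 1 ≤ i) (hi : i < n) : gen n i ∈ M₁b n :=
  Submonoid.subset_closure ⟨i, h, hi, rfl⟩
lemma gen_mem_Nb {i : ℕ} (hi : i + 1 < n) : gen n i ∈ Nb n := Submonoid.subset_closure ⟨i, hi, rfl⟩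

lemma M₁b_le : M₁b n ≤ Mb n := by
  rw [M₁b, Submonoid.closure_le]
  rintro _ ⟨i, -, hi, rfl⟩
  exact gen_mem_Mb hi

lemma Nb_le : Nb n ≤ Mb n := by
  rw [Nb, Submonoid.closure_le]
  rintro _ ⟨i, hi, rfl⟩
  exact gen_mem_Mb (by omega)

/-- The abelianisation of the braid group. -/
def len (n : ℕ) : Braid n →* Multiplicative ℤ :=
  braidLift (fun _ => Multiplicative.ofAdd 1) (fun _ _ => rfl) (fun _ _ _ _ => rfl)

lemma IsPos.len_eq {k : ℕ} {a : Braid n} (h : IsPos n k a) : len n a = Multiplicative.ofAdd (k : ℤ) := by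
  induction h with
  | one => simp
  | cons i hi _ ih =>
    rw [map_mul, ih, len, braidLift_gen _ _ hi, ← ofAdd_add, Nat.cast_succ, add_comm]

lemma eq_one_of_inv_mem {a : Braid n} (h : a ∈ Mb n) (h' : a⁻¹ ∈ Mb n) : a = 1 := by
  obtain ⟨k, hk⟩ := exists_isPos h
  obtain ⟨k', hk'⟩ := exists_isPos h'
  have e := map_mul (len n) a a⁻¹
  rw [mul_inv_cancel, map_one, hk.len_eq, hk'.len_eq, ← ofAdd_add, eq_comm, ofAdd_eq_one] at e
  obtain rfl : k = 0 := by omega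
  cases hk
  rfl

/-- The reversal of the generators. -/
def flip (n : ℕ) : Braid n →* Braid n :=
  braidLift (fun i => gen n (n - 1 - i))
    (fun i hi => by
      have := gen_braid (n := n) (i := n - 1 - (i + 1)) (by omega)
      rw [show n - 1 - (i + 1) + 1 = n - 1 - i by omega] at this
      exact this.symm)
    (fun i j hij hj => (gen_comm (by omega)).symm)

lemma flip_gen {i : ℕ} (hi : i < n) : flip n (gen n i) = gen n (n - 1 - i) := braidLift_gen _ _ hi

lemma flip_flip (g : Braid n) : flip n (flip n g) = g := by
  have := braid_mem_of_gen (((flip n).comp (flip n)).eqLocus (MonoidHom.id _)) (fun i hi => by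
    change flip n (flip n (gen n i)) = gen n i
    rw [flip_gen hi, flip_gen (by omega), show n - 1 - (n - 1 - i) = i by omega]) g
  exact this

lemma flip_mem_Mb {a : Braid n} (h : a ∈ Mb n) : flip n a ∈ Mb n := by
  refine (Submonoid.closure_le (S := (Mb n).comap (flip n))).2 ?_ h
  rintro _ ⟨i, hi, rfl⟩
  change flip n _ ∈ Mb n
  rw [flip_gen hi]
  exact gen_mem_Mb (by omega)

lemma flip_mem_Nb {a : Braid n} (h : a ∈ M₁b n) : flip n a ∈ Nb n := by
  refine (Submonoid.closure_le (S := (Nb n).comap (flip n))).2 ?_ h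
  rintro _ ⟨i, hi, hi', rfl⟩
  change flip n _ ∈ Nb n
  rw [flip_gen hi']
  exact gen_mem_Nb (by omega)

lemma flip_mem_M₁b {a : Braid n} (h : a ∈ Nb n) : flip n a ∈ M₁b n := by
  refine (Submonoid.closure_le (S := (M₁b n).comap (flip n))).2 ?_ h
  rintro _ ⟨i, hi, rfl⟩
  change flip n _ ∈ M₁b n
  rw [flip_gen (by omega)]
  exact gen_mem_M₁b (by omega) (by omega)

end Algebra

section Action

variable {n : ℕ}

/-- The action of the braid group on the free group. -/
def act (n : ℕ) : Braid n →* MulAut (FreeGroup ℤ) :=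
  braidLift (fun i => tau ((i : ℤ) + 1))
    (fun i _ => by
      have := tau_braid ((i : ℤ) + 1)
      push_cast
      exact this)
    (fun i j hij _ => tau_comm (by omega))

lemma act_gen {i : ℕ} (hi : i < n) : act n (gen n i) = tau ((i : ℤ) + 1) := braidLift_gen _ _ hi

lemma act_mem (g : Braid n) : act n g ∈ orderAut n :=
  braid_mem_of_gen ((orderAut n).comap (act n)) (fun i hi => by
    change act n _ ∈ orderAut n
    rw [act_gen hi]
    exact tau_mem_orderAut (by omega) (by omega)) g

/-- The image of the base arc under a braid. -/
def arc (n : ℕ) (g : Braid n) : FreeGroup ℤ := act n g t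

lemma arc_mul (g h : Braid n) : arc n (g * h) = act n g (arc n h) := by
  rw [arc, map_mul, MulAut.mul_apply, arc]

lemma arc_one : arc n 1 = t := by rw [arc, map_one, MulAut.one_apply]

lemma arc_gen_mul {i : ℕ} (hi : i < n) (a : Braid n) :
    arc n (gen n i * a) = tau ((i : ℤ) + 1) (arc n a) := by
  rw [arc_mul, act_gen hi]

lemma curve_arc (g : Braid n) : Curve n (arc n g) := (curve_t n).map (act_mem g)

/-- The rational point describing the image of the base arc. -/
def pos (n : ℕ) (g : Braid n) : ℚ := pt (arc n g)

lemma pos_mul_lt {g h k : Braid n} : pos n (g * h) < pos n (g * k) ↔ pos n h < pos n k := by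
  rw [pos, pos, arc_mul, arc_mul]
  exact (act_mem g).2.1 _ (curve_arc h).mem _ (curve_arc k).mem (curve_arc h).ne_one
    (curve_arc k).ne_one

lemma pos_mul_le {g h k : Braid n} : pos n (g * h) ≤ pos n (g * k) ↔ pos n h ≤ pos n k := by
  rw [← not_lt, ← not_lt, pos_mul_lt]

lemma arc_eq_of_pos_eq {g h : Braid n} (e : pos n g = pos n h) : arc n g = arc n h :=
  pt_injective (curve_arc g).mem (curve_arc h).mem (curve_arc g).ne_one (curve_arc h).ne_one e

lemma pos_eq_iff {g h : Braid n} : pos n g = pos n h ↔ arc n g = arc n h :=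
  ⟨arc_eq_of_pos_eq, fun h => by rw [pos, h, pos]⟩

lemma arc_mul_left_cancel {g h k : Braid n} (e : arc n (g * h) = arc n (g * k)) :
    arc n h = arc n k := by
  rw [arc_mul, arc_mul] at e
  exact (act n g).injective e

lemma tau_t {i : ℤ} (h : 2 ≤ i) : tau i t = t := by
  rw [t, map_mul, map_inv, tau_x_ne (by omega), tau_x_ne (by omega)]

lemma arc_of_mem_M₁b {m : Braid n} (h : m ∈ M₁b n) : arc n m = t := by
  induction h using Submonoid.closure_induction_left with
  | one => exact arc_one
  | mul_left g hg a _ ih =>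
    obtain ⟨i, hi, hi', rfl⟩ := hg
    rw [arc_gen_mul hi', ih, tau_t (by omega)]

lemma arc_mul_M₁b (g : Braid n) {m : Braid n} (h : m ∈ M₁b n) : arc n (g * m) = arc n g := by
  rw [arc_mul, arc_of_mem_M₁b h, arc]

lemma pos_mul_M₁b (g : Braid n) {m : Braid n} (h : m ∈ M₁b n) : pos n (g * m) = pos n g := by
  rw [pos, arc_mul_M₁b g h, pos]

lemma arc_segRev {k : ℕ} (h : k ≤ n) : arc n (segRev n 0 k) = x k * (x (k + 1))⁻¹ := by
  induction k with
  | zero => rw [segRev_zero, arc_one]; simp [t]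
  | succ k ih =>
    rw [segRev_succ, arc_gen_mul h, ih (by omega), map_mul, map_inv, tau_x_ne (by omega), tau_x_self]
    push_cast
    rw [show (k : ℤ) + 1 - 1 = k by ring]
    group

/-- The arcs between the last arc and its full twist. -/
def farArc (n : ℕ) (i : ℤ) : FreeGroup ℤ :=
  x (n + 1) * (x i)⁻¹ * x (i - 1) * (x (n + 1))⁻¹

lemma tau_farArc {i : ℤ} (h : i ≤ n) : tau i (farArc n (i + 1)) = farArc n i := by
  rw [farArc, farArc, show i + 1 - 1 = i by ring]
  simp only [map_mul, map_inv]
  rw [tau_x_ne (show (n : ℤ) + 1 ≠ i by omega), tau_x_ne (show i + 1 ≠ i by omega), tau_x_self]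
  group

lemma act_seg_farArc {k : ℕ} (h : k ≤ n) : act n (seg n 0 k) (farArc n (k + 1)) = farArc n 1 := by
  induction k with
  | zero => rw [seg_zero_zero, map_one, MulAut.one_apply]; simp
  | succ k ih =>
    rw [seg_zero_succ, map_mul, MulAut.mul_apply, act_gen h]
    push_cast
    rw [tau_farArc (by omega), ih (by omega)]

lemma Δ₁b_mem : Δ₁b n ∈ M₁b n := by
  refine pow_mem ?_ n
  rw [seg]
  refine Submonoid.list_prod_mem _ fun y hy => ?_
  obtain ⟨i, hi, rfl⟩ := List.mem_map.1 hy
  obtain ⟨j, hj, rfl⟩ := List.getElem_of_mem hi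
  simp at hj
  simp only [List.getElem_drop, List.getElem_range]
  exact gen_mem_M₁b (by omega) (by omega)

lemma arc_theta : arc n (seg n 0 n * segRev n 0 n) = farArc n 1 := by
  rw [arc_mul, arc_segRev le_rfl, ← act_seg_farArc le_rfl, farArc]
  simp

lemma arc_delta : arc n (Δb n) = farArc n 1 := by
  rw [delta_eq, arc_mul_M₁b _ Δ₁b_mem, arc_theta]

lemma farArc_one : farArc n 1 = bdry n * t * (bdry n)⁻¹ := by
  simp [farArc, bdry, t, mul_assoc]

lemma farArc_one_eq_ev : farArc n 1 = ev [(n : ℤ) + 1, -1, 0, -((n : ℤ) + 1)] := by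
  rw [ev_cons_cons, ev_cons_cons, ev_nil]
  simp [farArc, mul_assoc]

/-- Conjugation by a power of the boundary element. -/
def twist (n p : ℕ) (α : FreeGroup ℤ) : FreeGroup ℤ := bdry n ^ p * α * (bdry n ^ p)⁻¹

lemma twist_succ (p : ℕ) (α : FreeGroup ℤ) :
    twist n (p + 1) α = bdry n * twist n p α * (bdry n)⁻¹ := by
  simp only [twist, pow_succ', mul_inv_rev, mul_assoc]

lemma arc_delta_mul (g : Braid n) : arc n (Δb n * g) = bdry n * arc n g * (bdry n)⁻¹ := by
  rw [delta_central, arc_mul, arc_delta, farArc_one, map_mul, map_mul, map_inv, (act_mem g).2.2, arc]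

lemma arc_delta_pow_mul (p : ℕ) (g : Braid n) : arc n (Δb n ^ p * g) = twist n p (arc n g) := by
  induction p with
  | zero => simp [twist]
  | succ p ih => rw [pow_succ', mul_assoc, arc_delta_mul, ih, twist_succ]

lemma arc_delta_pow (p : ℕ) : arc n (Δb n ^ p) = twist n p t := by
  rw [← mul_one (Δb n ^ p), arc_delta_pow_mul, arc_one]

lemma twist_mem (p : ℕ) {α : FreeGroup ℤ} (h : α ∈ Fn n) : twist n p α ∈ Fn n :=
  mul_mem (mul_mem (pow_mem (bdry_mem n) p) h) (inv_mem (pow_mem (bdry_mem n) p))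

lemma Arc.twist {l : ℤ} (hl : 1 ≤ l) {α : FreeGroup ℤ} (hα : α ∈ Fn n) (h : Arc n l α) (p : ℕ) :
    Arc n l (twist n p α) := by
  induction p with
  | zero => simpa [BraidCurve.twist] using h
  | succ p ih =>
    rw [twist_succ]
    exact arc_conj hl (twist_mem p hα) ih

lemma tau_twist {i : ℤ} (h1 : 1 ≤ i) (h2 : i ≤ n) (p : ℕ) (α : FreeGroup ℤ) :
    tau i (twist n p α) = twist n p (tau i α) := by
  simp only [twist, map_mul, map_inv, map_pow, tau_bdry h1 h2]

/-- An arc of index `l + 1` forces left divisibility by the generator of index `l`. -/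
lemma exists_eq_gen_mul {k : ℕ} {a : Braid n} (ha : IsPos n k a) {l : ℕ} (hl : l < n)
    (h : Arc n (l + 1) (arc n a)) : ∃ k' a', k = k' + 1 ∧ IsPos n k' a' ∧ a = gen n l * a' := by
  induction k using Nat.strong_induction_on generalizing a l with
  | _ k ih =>
    cases ha with
    | one =>
      rw [arc_one] at h
      exact absurd h (not_arc_t (by omega))
    | @cons k₁ a₁ i hi ha₁ =>
      by_cases hil : i = l
      · subst hil
        exact ⟨k₁, a₁, rfl, ha₁, rfl⟩
      rw [arc_gen_mul hi] at h
      have h' := arc_of_tau (curve_arc a₁).mem (by omega) (by omega) (by omega) (by omega) h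
      obtain ⟨k₂, a₂, rfl, ha₂, rfl⟩ := ih k₁ (by omega) ha₁ hl h'
      by_cases hadj : i + 1 = l
      · subst hadj
        rw [arc_gen_mul hl] at h
        have h2 : Arc n ((i : ℤ) + 1) (arc n a₂) := by
          have := arc_down (l := (i : ℤ) + 1 + 1) (curve_arc a₂).mem (by omega) (by omega)
            (by
              rw [show (i : ℤ) + 1 + 1 - 1 = i + 1 by ring]
              push_cast at h
              exact h)
          rwa [show (i : ℤ) + 1 + 1 - 1 = i + 1 by ring] at this
        obtain ⟨k₃, a₃, rfl, ha₃, rfl⟩ := ih k₂ (by omega) ha₂ hi h2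
        refine ⟨_, gen n i * (gen n (i + 1) * a₃), rfl, .cons i hi (.cons _ hl ha₃), ?_⟩
        rw [← mul_assoc, ← mul_assoc, gen_braid hl]
        simp only [mul_assoc]
      by_cases hadj' : l + 1 = i
      · subst hadj'
        rw [arc_gen_mul hl] at h
        push_cast at h
        have h2 := arc_up (curve_arc a₂).mem (by omega) (by omega) h
        obtain ⟨k₃, a₃, rfl, ha₃, rfl⟩ := ih k₂ (by omega) ha₂ hi (by push_cast; exact h2)
        refine ⟨_, gen n (l + 1) * (gen n l * a₃), rfl, .cons _ hi (.cons _ hl ha₃), ?_⟩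
        rw [← mul_assoc, ← mul_assoc, ← gen_braid hi]
        simp only [mul_assoc]
      · refine ⟨_, gen n i * a₂, rfl, .cons i hi ha₂, ?_⟩
        rw [← mul_assoc, ← mul_assoc]
        congr 1
        rcases lt_or_gt_of_ne hil with h3 | h3
        · exact gen_comm (by omega)
        · exact (gen_comm (by omega)).symm

lemma arc_farArc {i : ℤ} (h1 : 1 ≤ i) (h2 : i ≤ n) : Arc n i (farArc n i) := by
  refine ⟨x i * (x (n + 1))⁻¹, x_mul_x_inv_mem (by omega) (by omega) (by omega) (by omega), .inr ?_⟩
  have e : x i * (x ((n : ℤ) + 1))⁻¹ * farArc n i = ev [i - 1, -((n : ℤ) + 1)] := by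
    rw [ev_pair, farArc]
    group
  rw [e, ← ev_pair]
  exact ⟨(inA_iff (red_cons_cons.2 ⟨by omega, red_singleton _⟩)).2 (by omega),
    (inB_iff (red_cons_cons.2 ⟨by omega, red_singleton _⟩)).2 ⟨rfl, by omega⟩⟩

lemma arc_consecutive {i : ℤ} (h1 : 1 ≤ i) : Arc n i (x i * (x (i + 1))⁻¹) := by
  refine ⟨1, one_mem _, .inl ⟨inA_one h1, ?_⟩⟩
  rw [one_mul, ← ev_pair]
  exact (inB_iff (red_cons_cons.2 ⟨by omega, red_singleton _⟩)).2 ⟨rfl, by omega⟩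

lemma farArc_mem {i : ℤ} (h1 : 1 ≤ i) (h2 : i ≤ n + 1) : farArc n i ∈ Fn n := by
  have : farArc n i = x (n + 1) * (x i)⁻¹ * (x (i - 1) * (x (n + 1))⁻¹) := by
    simp only [farArc, mul_assoc]
  rw [this]
  exact mul_mem (x_mul_x_inv_mem (by omega) (by omega) (by omega) (by omega))
    (x_mul_x_inv_mem (by omega) (by omega) (by omega) (by omega))

lemma exists_eq_gen_mul' {a : Braid n} (ha : a ∈ Mb n) {l : ℕ} (hl : l < n) {α : FreeGroup ℤ}
    (hα : arc n a = tau (l + 1) α) (h : Arc n (l + 1) (arc n a)) :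
    ∃ a' ∈ Mb n, a = gen n l * a' ∧ arc n a' = α := by
  obtain ⟨k, hk⟩ := exists_isPos ha
  obtain ⟨k', a', rfl, ha', rfl⟩ := exists_eq_gen_mul hk hl h
  rw [arc_gen_mul hl] at hα
  exact ⟨a', ha'.mem, rfl, (tau _).injective hα⟩

lemma exists_eq_seg_mul {a : Braid n} (ha : a ∈ Mb n) {p : ℕ} (h : arc n a = twist n p (farArc n 1))
    {k : ℕ} (hk : k ≤ n) :
    ∃ a' ∈ Mb n, a = seg n 0 k * a' ∧ arc n a' = twist n p (farArc n (k + 1)) := by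
  induction k with
  | zero => exact ⟨a, ha, by rw [seg_zero_zero, one_mul], by simpa using h⟩
  | succ k ih =>
    obtain ⟨b, hb, rfl, e⟩ := ih (by omega)
    obtain ⟨c, hc, rfl, e'⟩ := exists_eq_gen_mul' hb (l := k) hk
      (α := twist n p (farArc n (k + 1 + 1)))
      (by rw [e, tau_twist (by omega) (by omega), tau_farArc (by omega)])
      (by rw [e]
          exact (arc_farArc (by omega) (by omega)).twist (by omega)
            (farArc_mem (by omega) (by omega)) p)
    exact ⟨c, hc, by rw [seg_zero_succ, mul_assoc], by rw [e']; push_cast; rfl⟩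

lemma exists_eq_segRev_mul {k : ℕ} (hk : k ≤ n) {a : Braid n} (ha : a ∈ Mb n) {p : ℕ}
    (h : arc n a = twist n p (x k * (x (k + 1))⁻¹)) :
    ∃ a' ∈ Mb n, a = segRev n 0 k * a' ∧ arc n a' = twist n p t := by
  induction k generalizing a with
  | zero => exact ⟨a, ha, by rw [segRev_zero, one_mul], by simpa [t] using h⟩
  | succ k ih =>
    push_cast at h
    obtain ⟨c, hc, rfl, e'⟩ := exists_eq_gen_mul' ha (l := k) hk
      (α := twist n p (x k * (x (k + 1))⁻¹))
      (by
        rw [h, tau_twist (by omega) (by omega), map_mul, map_inv, tau_x_ne (by omega), tau_x_self,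
          show (k : ℤ) + 1 - 1 = k by ring]
        congr 1
        group)
      (by rw [h]
          exact (arc_consecutive (by omega)).twist (by omega)
            (x_mul_x_inv_mem (by omega) (by omega) (by omega) (by omega)) p)
    obtain ⟨d, hd, rfl, e⟩ := ih (by omega) hc e'
    exact ⟨d, hd, by rw [segRev_succ, mul_assoc], e⟩

end Action

section Position

variable {n : ℕ}

lemma pos_gen_zero (hn : 1 ≤ n) : pos n 1 < pos n (gen n 0) := by
  have h := arc_segRev hn
  rw [segRev_succ, segRev_zero, mul_one, ← ev_pair] at h
  rw [pos, pos, h, arc_one, t_eq]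
  exact pt_lt_of_head_lt (red_cons_cons.2 ⟨by omega, red_singleton _⟩)
    (red_cons_cons.2 ⟨by omega, red_singleton _⟩) (by simp)

lemma pos_gen {i : ℕ} (h : 1 ≤ i) (hi : i < n) : pos n (gen n i) = pos n 1 := by
  rw [← one_mul (gen n i), pos_mul_M₁b _ (gen_mem_M₁b h hi)]

lemma pos_segRev : pos n (segRev n 0 n) = pt (ev [(n : ℤ), -((n : ℤ) + 1)]) := by
  rw [pos, arc_segRev le_rfl, ev_pair]

lemma red_far (hn : 1 ≤ n) : Red [(n : ℤ) + 1, -1, 0, -((n : ℤ) + 1)] :=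
  red_cons_cons.2 ⟨by omega, red_cons_cons.2 ⟨by simp, red_cons_cons.2 ⟨by omega, red_singleton _⟩⟩⟩

lemma pos_delta : pos n (Δb n) = pt (ev [(n : ℤ) + 1, -1, 0, -((n : ℤ) + 1)]) := by
  rw [pos, arc_delta, farArc_one_eq_ev]

lemma pos_one_lt_segRev (hn : 1 ≤ n) : pos n 1 < pos n (segRev n 0 n) := by
  rw [pos_segRev, pos, arc_one, t_eq]
  exact pt_lt_of_head_lt (red_cons_cons.2 ⟨by omega, red_singleton _⟩)
    (red_cons_cons.2 ⟨by omega, red_singleton _⟩) (by omega)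

lemma pos_segRev_lt_delta (hn : 1 ≤ n) : pos n (segRev n 0 n) < pos n (Δb n) := by
  rw [pos_segRev, pos_delta]
  exact pt_lt_of_head_lt (red_cons_cons.2 ⟨by omega, red_singleton _⟩) (red_far hn) (by omega)

lemma pos_one_lt_delta (hn : 1 ≤ n) : pos n 1 < pos n (Δb n) :=
  (pos_one_lt_segRev hn).trans (pos_segRev_lt_delta hn)

lemma pos_gen_lt_delta {i : ℕ} (hi : i < n) : pos n (gen n i) < pos n (Δb n) := by
  rcases Nat.eq_zero_or_pos i with rfl | h
  · have h := arc_segRev (n := n) (k := 1) hi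
    rw [segRev_succ, segRev_zero, mul_one, ← ev_pair] at h
    rw [pos_delta, pos, h]
    exact pt_lt_of_head_lt (red_cons_cons.2 ⟨by omega, red_singleton _⟩) (red_far (by omega))
      (by push_cast; omega)
  · rw [pos_gen h hi]
    exact pos_one_lt_delta (by omega)

lemma pos_one_le_gen {i : ℕ} (hi : i < n) : pos n 1 ≤ pos n (gen n i) := by
  rcases Nat.eq_zero_or_pos i with rfl | h
  · exact (pos_gen_zero hi).le
  · exact (pos_gen h hi).ge

lemma pos_one_le {a : Braid n} (ha : a ∈ Mb n) : pos n 1 ≤ pos n a := by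
  obtain ⟨k, hk⟩ := exists_isPos ha
  induction hk with
  | one => exact le_rfl
  | @cons k a i hi h ih =>
    refine (pos_one_le_gen hi).trans ?_
    rw [← mul_one (gen n i), mul_assoc, one_mul, pos_mul_le]
    exact ih h.mem

lemma mem_M₁b_of_pos_eq {a : Braid n} (ha : a ∈ Mb n) (h : pos n a = pos n 1) : a ∈ M₁b n := by
  obtain ⟨k, hk⟩ := exists_isPos ha
  induction hk with
  | one => exact one_mem _
  | @cons k a i hi hk ih =>
    have h1 : pos n (gen n i * 1) ≤ pos n (gen n i * a) := pos_mul_le.2 (pos_one_le hk.mem)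
    rcases Nat.eq_zero_or_pos i with rfl | h0
    · rw [mul_one, h] at h1
      exact absurd h1 (pos_gen_zero hi).not_ge
    · refine mul_mem (gen_mem_M₁b h0 hi) (ih hk.mem (le_antisymm ?_ (pos_one_le hk.mem)))
      rw [← pos_mul_le (g := gen n i), h, mul_one, pos_gen h0 hi]

lemma pos_mul_segRev {ν : Braid n} (h : ν ∈ Nb n) : pos n (ν * segRev n 0 n) = pos n (segRev n 0 n) := by
  rw [pos_eq_iff]
  induction h using Submonoid.closure_induction_left with
  | one => rw [one_mul]
  | mul_left g hg a _ ih =>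
    obtain ⟨i, hi, rfl⟩ := hg
    rw [mul_assoc, arc_gen_mul (by omega), ih, arc_segRev le_rfl, map_mul, map_inv,
      tau_x_ne (by omega), tau_x_ne (by omega)]

lemma pos_delta_pow_strictMono (hn : 1 ≤ n) : StrictMono fun p => pos n (Δb n ^ p) := by
  refine strictMono_nat_of_lt_succ fun p => ?_
  rw [pow_succ, ← mul_one (Δb n ^ p), mul_assoc, one_mul, pos_mul_lt]
  exact pos_one_lt_delta hn

lemma exists_pos_lt_delta_pow (hn : 1 ≤ n) {a : Braid n} (ha : a ∈ Mb n) :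
    ∃ p, pos n a < pos n (Δb n ^ p) := by
  obtain ⟨k, hk⟩ := exists_isPos ha
  induction hk with
  | one => exact ⟨1, by rw [pow_one]; exact pos_one_lt_delta hn⟩
  | @cons k a i hi hk ih =>
    obtain ⟨p, hp⟩ := ih hk.mem
    refine ⟨p + 1, (pos_mul_lt.2 hp).trans ?_⟩
    rw [← delta_pow_central, pow_succ, pos_mul_lt]
    exact pos_gen_lt_delta hi

lemma exists_arc_of_lt_segRev {p : ℕ} {a : Braid n} (h1 : pos n (Δb n ^ p) ≤ pos n a)
    (h2 : pos n a < pos n (Δb n ^ p * segRev n 0 n)) (h3 : p = 0 → pos n a ≠ pos n 1) (hn : 2 ≤ n) :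
    ∃ l : ℕ, l + 1 < n ∧ Arc n (l + 1) (arc n a) := by
  rcases h1.eq_or_lt with h1 | h1
  · obtain _ | p := p
    · exact absurd (by simpa using h1.symm) (h3 rfl)
    · refine ⟨0, by omega, ?_⟩
      rw [← arc_eq_of_pos_eq h1, pow_succ, arc_delta_pow_mul, arc_delta]
      exact (arc_farArc (i := 1) le_rfl (by omega)).twist le_rfl (farArc_mem le_rfl (by omega)) p
  · obtain ⟨g, rfl⟩ : ∃ g, a = Δb n ^ p * g := ⟨(Δb n ^ p)⁻¹ * a, by group⟩
    rw [← mul_one (Δb n ^ p), mul_assoc, one_mul, pos_mul_lt] at h1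
    rw [pos_mul_lt, pos_segRev] at h2
    rw [pos, arc_one] at h1
    obtain ⟨l, hl1, hl2, hl⟩ := exists_arc_low (curve_arc g) h1 h2
    refine ⟨(l - 1).toNat, by omega, ?_⟩
    rw [arc_delta_pow_mul, show (((l - 1).toNat : ℕ) : ℤ) + 1 = l by omega]
    exact hl.twist hl1 (curve_arc g).mem p

lemma exists_arc_of_segRev_le {p : ℕ} {a : Braid n}
    (h1 : pos n (Δb n ^ p * segRev n 0 n) ≤ pos n a)
    (h2 : pos n a < pos n (Δb n ^ (p + 1))) (hn : 2 ≤ n) :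
    ∃ l : ℕ, 1 ≤ l ∧ l < n ∧ Arc n (l + 1) (arc n a) := by
  obtain ⟨g, rfl⟩ : ∃ g, a = Δb n ^ p * g := ⟨(Δb n ^ p)⁻¹ * a, by group⟩
  rw [pos_mul_le, pos_segRev] at h1
  rw [pow_succ, pos_mul_lt, pos_delta] at h2
  obtain ⟨l, hl1, hl2, hl⟩ := exists_arc_high hn (curve_arc g) h1 h2
  refine ⟨(l - 1).toNat, by omega, by omega, ?_⟩
  rw [arc_delta_pow_mul, show (((l - 1).toNat : ℕ) : ℤ) + 1 = l by omega]
  exact hl.twist (by omega) (curve_arc g).mem p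

lemma exists_arc (hn : 2 ≤ n) {a : Braid n} (ha : a ∈ Mb n) (h : pos n a ≠ pos n 1) :
    ∃ l : ℕ, l < n ∧ Arc n (l + 1) (arc n a) := by
  classical
  have hex := exists_pos_lt_delta_pow (by omega) ha
  obtain ⟨p, hp⟩ : ∃ p, Nat.find hex = p := ⟨_, rfl⟩
  have hlt := Nat.find_spec hex
  rw [hp] at hlt
  obtain _ | p := p
  · rw [pow_zero] at hlt
    exact absurd (pos_one_le ha) hlt.not_ge
  have hge : pos n (Δb n ^ p) ≤ pos n a := not_lt.1 (Nat.find_min hex (by omega))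
  rcases lt_or_ge (pos n a) (pos n (Δb n ^ p * segRev n 0 n)) with h2 | h2
  · obtain ⟨l, hl, h⟩ := exists_arc_of_lt_segRev hge h2 (fun _ => h) hn
    exact ⟨l, by omega, h⟩
  · obtain ⟨l, -, hl, h⟩ := exists_arc_of_segRev_le h2 hlt hn
    exact ⟨l, hl, h⟩

/-- The alternating products of `p + 1` elements of `M₁` and `p` elements of `N`. -/
inductive Alt (n : ℕ) : ℕ → Braid n → Prop
  | base {m : Braid n} (hm : m ∈ M₁b n) : Alt n 0 m
  | step {p : ℕ} {m ν y : Braid n} (hm : m ∈ M₁b n) (hν : ν ∈ Nb n) (hy : Alt n p y) :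
      Alt n (p + 1) (m * (ν * y))

lemma Alt.mul_left {p : ℕ} {m y : Braid n} (hm : m ∈ M₁b n) (hy : Alt n p y) : Alt n p (m * y) := by
  cases hy with
  | base h => exact .base (mul_mem hm h)
  | step h hν hy =>
    rw [← mul_assoc]
    exact .step (mul_mem hm h) hν hy

lemma Alt.mul_left_succ {p : ℕ} {ν y : Braid n} (hν : ν ∈ Nb n) (hy : Alt n p y) :
    Alt n (p + 1) (ν * y) := by
  rw [← one_mul (ν * y)]
  exact .step (one_mem _) hν hy

lemma Alt.exists_eq_mul {p : ℕ} {a : Braid n} (h : Alt n (p + 1) a) :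
    ∃ y ν m, Alt n p y ∧ ν ∈ Nb n ∧ m ∈ M₁b n ∧ a = y * ν * m := by
  induction p generalizing a with
  | zero =>
    obtain _ | ⟨hm, hν, hy⟩ := h
    cases hy with
    | base hy => exact ⟨_, _, _, .base hm, hν, hy, by rw [mul_assoc]⟩
  | succ p ih =>
    obtain _ | ⟨hm, hν, hy⟩ := h
    obtain ⟨y, ν', m', h1, h2, h3, rfl⟩ := ih hy
    exact ⟨_, ν', m', .step hm hν h1, h2, h3, by simp only [mul_assoc]⟩

lemma Alt.mem {p : ℕ} {a : Braid n} (h : Alt n p a) : a ∈ Mb n := by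
  induction h with
  | base hm => exact M₁b_le hm
  | step hm hν _ ih => exact mul_mem (M₁b_le hm) (mul_mem (Nb_le hν) ih)

lemma pos_lt_delta_of_mem_Nb (hn : 1 ≤ n) {ν : Braid n} (h : ν ∈ Nb n) :
    pos n ν < pos n (Δb n) := by
  refine lt_trans ?_ (pos_segRev_lt_delta hn)
  rw [← pos_mul_segRev h]
  nth_rewrite 1 [← mul_one ν]
  exact pos_mul_lt.2 (pos_one_lt_segRev hn)

lemma Alt.pos_lt (hn : 1 ≤ n) {p : ℕ} {a : Braid n} (h : Alt n (p + 1) a) :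
    pos n a < pos n (Δb n ^ (p + 1)) := by
  have key : ∀ {p : ℕ} {m ν y : Braid n}, m ∈ M₁b n → ν ∈ Nb n → pos n y ≤ pos n (Δb n ^ p) →
      pos n (m * (ν * y)) < pos n (Δb n ^ (p + 1)) := fun {p m ν y} hm hν hy => by
    rw [← mul_assoc]
    refine (pos_mul_le.2 hy).trans_lt ?_
    rw [← delta_pow_central, pow_succ, pos_mul_lt, ← pos_mul_M₁b (Δb n) hm, delta_central,
      pos_mul_lt]
    exact pos_lt_delta_of_mem_Nb hn hν
  induction p generalizing a with
  | zero =>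
    obtain _ | ⟨hm, hν, hy⟩ := h
    cases hy with
    | base hy =>
      refine key hm hν (le_of_eq ?_)
      rw [pow_zero, pos_eq_iff, arc_of_mem_M₁b hy, arc_one]
  | succ p ih =>
    obtain _ | ⟨hm, hν, hy⟩ := h
    exact key hm hν (ih hy).le

lemma alt_of_isPos (hn : 2 ≤ n) {k : ℕ} {a : Braid n} (ha : IsPos n k a) (p : ℕ) :
    (pos n a < pos n (Δb n ^ p) → Alt n p a) ∧
    (pos n a < pos n (Δb n ^ p * segRev n 0 n) → ∃ ν ∈ Nb n, ∃ y, Alt n p y ∧ a = ν * y) := by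
  induction k using Nat.strong_induction_on generalizing a p with
  | _ k ihk =>
    have step : ∀ p, (pos n a < pos n (Δb n ^ p) → Alt n p a) →
        pos n a < pos n (Δb n ^ p * segRev n 0 n) → ∃ ν ∈ Nb n, ∃ y, Alt n p y ∧ a = ν * y := by
      intro p h1 h2
      rcases lt_or_ge (pos n a) (pos n (Δb n ^ p)) with h | h
      · exact ⟨1, one_mem _, a, h1 h, (one_mul a).symm⟩
      by_cases h0 : p = 0 ∧ pos n a = pos n 1
      · obtain ⟨rfl, h0⟩ := h0
        exact ⟨1, one_mem _, a, .base (mem_M₁b_of_pos_eq ha.mem h0), (one_mul a).symm⟩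
      obtain ⟨l, hl, harc⟩ := exists_arc_of_lt_segRev h h2 (fun e e' => h0 ⟨e, e'⟩) hn
      obtain ⟨k', a', rfl, ha', rfl⟩ := exists_eq_gen_mul ha (by omega) harc
      have hν := gen_mem_Nb hl
      have hfix : pos n (gen n l * (Δb n ^ p * segRev n 0 n)) =
          pos n (Δb n ^ p * segRev n 0 n) := by
        rw [← mul_assoc, ← delta_pow_central, mul_assoc, pos_eq_iff, arc_mul,
          arc_eq_of_pos_eq (pos_mul_segRev hν), ← arc_mul]
      rw [← hfix, pos_mul_lt] at h2
      obtain ⟨ν, hν', y, hy, rfl⟩ := (ihk k' (by omega) ha' p).2 h2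
      exact ⟨gen n l * ν, mul_mem hν hν', y, hy, (mul_assoc _ _ _).symm⟩
    have first : pos n a < pos n (Δb n ^ p) → Alt n p a := by
      induction p with
      | zero =>
        intro h
        rw [pow_zero] at h
        exact absurd (pos_one_le ha.mem) h.not_ge
      | succ p ih =>
        intro h
        rcases lt_or_ge (pos n a) (pos n (Δb n ^ p * segRev n 0 n)) with h2 | h2
        · obtain ⟨ν, hν, y, hy, rfl⟩ := step p ih h2
          exact hy.mul_left_succ hν
        obtain ⟨l, hl1, hl, harc⟩ := exists_arc_of_segRev_le h2 h hn
        obtain ⟨k', a', rfl, ha', rfl⟩ := exists_eq_gen_mul ha hl harc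
        have hm := gen_mem_M₁b hl1 hl
        rw [← pos_mul_M₁b (Δb n ^ (p + 1)) hm, delta_pow_central, pos_mul_lt] at h
        exact ((ihk k' (by omega) ha' (p + 1)).1 h).mul_left hm
    exact ⟨first, step p first⟩

lemma alt_of_pos_lt (hn : 2 ≤ n) {a : Braid n} (ha : a ∈ Mb n) {p : ℕ}
    (h : pos n a < pos n (Δb n ^ p)) : Alt n p a := by
  obtain ⟨k, hk⟩ := exists_isPos ha
  exact (alt_of_isPos hn hk p).1 h

/-- A positive braid whose arc is that of a power of `Δ` is a power of `θ` times an element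
of `M₁`. -/
lemma exists_eq_theta_pow_mul {p : ℕ} {a : Braid n} (ha : a ∈ Mb n)
    (h : pos n a = pos n (Δb n ^ p)) :
    ∃ m ∈ M₁b n, a = (Δb n * (Δ₁b n)⁻¹) ^ p * m := by
  induction p generalizing a with
  | zero =>
    rw [pow_zero] at h
    exact ⟨a, mem_M₁b_of_pos_eq ha h, by rw [pow_zero, one_mul]⟩
  | succ p ih =>
    rw [pos_eq_iff, pow_succ, arc_delta_pow_mul, arc_delta] at h
    obtain ⟨b, hb, rfl, e⟩ := exists_eq_seg_mul ha h le_rfl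
    rw [farArc] at e
    obtain ⟨c, hc, rfl, e'⟩ := exists_eq_segRev_mul (p := p) le_rfl hb (by rw [e]; simp)
    obtain ⟨m, hm, rfl⟩ := ih hc (pos_eq_iff.2 (by rw [e', arc_delta_pow]))
    exact ⟨m, hm, by rw [pow_succ', theta_eq]; simp only [mul_assoc]⟩

/-- Positive braids with a common arc share a left divisor with cofactors in `M₁`. -/
lemma exists_common_left (hn : 2 ≤ n) {k : ℕ} {a : Braid n} (ha : IsPos n k a) :
    ∃ z ∈ Mb n, ∀ b ∈ Mb n, arc n b = arc n a → ∃ m ∈ M₁b n, b = z * m := by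
  induction k using Nat.strong_induction_on generalizing a with
  | _ k ih =>
    by_cases h : pos n a = pos n 1
    · exact ⟨1, one_mem _, fun b hb e =>
        ⟨b, mem_M₁b_of_pos_eq hb ((pos_eq_iff.2 e).trans h), (one_mul b).symm⟩⟩
    obtain ⟨l, hl, harc⟩ := exists_arc hn ha.mem h
    obtain ⟨k', a', rfl, ha', rfl⟩ := exists_eq_gen_mul ha hl harc
    obtain ⟨z, hz, H⟩ := ih k' (by omega) ha'
    refine ⟨gen n l * z, mul_mem (gen_mem_Mb hl) hz, fun b hb e => ?_⟩
    obtain ⟨j, hj⟩ := exists_isPos hb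
    obtain ⟨j', b', rfl, hb', rfl⟩ := exists_eq_gen_mul hj hl (e ▸ harc)
    obtain ⟨m, hm, rfl⟩ := H b' hb'.mem (arc_mul_left_cancel e)
    exact ⟨m, hm, (mul_assoc _ _ _).symm⟩

/-- The element `m` is the greatest right divisor of `a` in the submonoid `L`. -/
def IsTail (n : ℕ) (L : Submonoid (Braid n)) (a m : Braid n) : Prop :=
  m ∈ L ∧ a * m⁻¹ ∈ Mb n ∧ ∀ c ∈ L, a * c⁻¹ ∈ Mb n → m * c⁻¹ ∈ Mb n

lemma exists_isTail_M₁b (hn : 2 ≤ n) {a : Braid n} (ha : a ∈ Mb n) :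
    ∃ m, IsTail n (M₁b n) a m := by
  obtain ⟨k, hk⟩ := exists_isPos ha
  obtain ⟨z, hz, H⟩ := exists_common_left hn hk
  obtain ⟨m, hm, rfl⟩ := H a ha rfl
  refine ⟨m, hm, by simpa using hz, fun c hc h => ?_⟩
  obtain ⟨m', hm', e⟩ := H _ h (by
    have := arc_mul_M₁b (z * m * c⁻¹) hc
    rwa [inv_mul_cancel_right, eq_comm] at this)
  rw [mul_assoc] at e
  rw [mul_left_cancel e]
  exact M₁b_le hm'

lemma exists_isTail_Nb (hn : 2 ≤ n) {a : Braid n} (ha : a ∈ Mb n) :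
    ∃ m, IsTail n (Nb n) a m := by
  obtain ⟨m, h1, h2, h3⟩ := exists_isTail_M₁b hn (flip_mem_Mb ha)
  refine ⟨flip n m, flip_mem_Nb h1, ?_, fun c hc h => ?_⟩
  · simpa [flip_flip] using flip_mem_Mb h2
  · have := h3 (flip n c) (flip_mem_M₁b hc) (by simpa using flip_mem_Mb h)
    simpa [flip_flip] using flip_mem_Mb this

lemma isTail_tail {L : Submonoid (Braid n)} {a m : Braid n} (h : IsTail n L a m) :
    IsTail n L a (tail (Mb n) L a) := by
  have hex : ∃ b : Braid n, b ∈ L ∧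
      {c | c ∈ L ∧ leR (Mb n) c a} = {c | c ∈ L ∧ leR (Mb n) c b} := by
    refine ⟨m, h.1, Set.ext fun c => ⟨fun hc => ⟨hc.1, h.2.2 c hc.1 hc.2⟩, fun hc => ⟨hc.1, ?_⟩⟩⟩
    have := mul_mem h.2.1 hc.2
    rwa [mul_assoc, inv_mul_cancel_left] at this
  have e : tail (Mb n) L a = hex.choose := dif_pos hex
  rw [e]
  obtain ⟨h1, h2⟩ := hex.choose_spec
  refine ⟨h1, ?_, fun c hc hca => ?_⟩
  · exact (h2.ge ⟨h1, by rw [leR, mul_inv_cancel]; exact one_mem _⟩ : _ ∈ {c | _}).2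
  · exact (h2.le ⟨hc, hca⟩ : _ ∈ {c | _}).2

lemma isTail_M₁b (hn : 2 ≤ n) {a : Braid n} (ha : a ∈ Mb n) :
    IsTail n (M₁b n) a (tail (Mb n) (M₁b n) a) :=
  isTail_tail (exists_isTail_M₁b hn ha).choose_spec

lemma isTail_Nb (hn : 2 ≤ n) {a : Braid n} (ha : a ∈ Mb n) :
    IsTail n (Nb n) a (tail (Mb n) (Nb n) a) :=
  isTail_tail (exists_isTail_Nb hn ha).choose_spec

lemma strip_one_of_mem (hn : 2 ≤ n) {a : Braid n} (ha : a ∈ M₁b n) :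
    strip (Mb n) (M₁b n) (Nb n) 1 a = 1 := by
  obtain ⟨-, h1, h2⟩ := isTail_M₁b hn (M₁b_le ha)
  refine eq_one_of_inv_mem h1 ?_
  simpa [strip] using h2 a ha (by simp)

lemma strip_add_two (i : ℕ) (a : Braid n) :
    strip (Mb n) (M₁b n) (Nb n) (i + 2) a =
      strip (Mb n) (M₁b n) (Nb n) i (strip (Mb n) (M₁b n) (Nb n) 2 a) := by
  induction i with
  | zero => rfl
  | succ i ih =>
    rw [show i + 1 + 2 = (i + 2) + 1 by ring, strip, ih, Nat.add_mod_right]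
    rfl

lemma exists_alt_strip_two (hn : 2 ≤ n) {p : ℕ} {a : Braid n} (ha : a ∈ Mb n)
    (h : pos n a < pos n (Δb n ^ (p + 1))) :
    strip (Mb n) (M₁b n) (Nb n) 2 a ∈ Mb n ∧
      ∃ y, Alt n p y ∧ pos n (strip (Mb n) (M₁b n) (Nb n) 2 a) ≤ pos n y := by
  obtain ⟨h1, h2, h3⟩ := isTail_M₁b hn ha
  set r := tail (Mb n) (M₁b n) a
  set a' := a * r⁻¹ with ha'
  have hstrip : strip (Mb n) (M₁b n) (Nb n) 2 a = a' * (tail (Mb n) (Nb n) a')⁻¹ := rfl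
  obtain ⟨k1, k2, k3⟩ := isTail_Nb hn h2
  set s := tail (Mb n) (Nb n) a'
  have hpos : pos n a' = pos n a := by
    rw [← pos_mul_M₁b a' h1, ha', inv_mul_cancel_right]
  rw [← hpos] at h
  obtain ⟨y, ν, m, hy, hν, hm, e⟩ := (alt_of_pos_lt hn h2 h).exists_eq_mul
  have hm1 : m = 1 := by
    refine eq_one_of_inv_mem (M₁b_le hm) ?_
    have := h3 (m * r) (mul_mem hm h1) (by
      rw [mul_inv_rev, ← mul_assoc, ← ha', e, mul_inv_cancel_right]
      exact mul_mem hy.mem (Nb_le hν))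
    simpa using this
  rw [hm1, mul_one] at e
  have hs : s * ν⁻¹ ∈ Mb n := k3 ν hν (by rw [e, mul_inv_cancel_right]; exact hy.mem)
  rw [hstrip]
  refine ⟨k2, y, hy, ?_⟩
  have hy' : y = a' * s⁻¹ * (s * ν⁻¹) := by rw [e]; group
  rw [hy']
  nth_rewrite 1 [← mul_one (a' * s⁻¹)]
  exact pos_mul_le.2 (pos_one_le hs)

lemma strip_eq_one (hn : 2 ≤ n) {p : ℕ} {a : Braid n} (ha : a ∈ Mb n)
    (h : pos n a < pos n (Δb n ^ (p + 1))) :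
    strip (Mb n) (M₁b n) (Nb n) (2 * p + 3) a = 1 := by
  induction p generalizing a with
  | zero =>
    obtain ⟨hmem, y, hy, hle⟩ := exists_alt_strip_two hn ha h
    cases hy with
    | base hy =>
      rw [strip_add_two 1]
      refine strip_one_of_mem hn (mem_M₁b_of_pos_eq hmem (le_antisymm (hle.trans ?_) (pos_one_le hmem)))
      rw [pos, pos, arc_of_mem_M₁b hy, arc_one]
  | succ p ih =>
    obtain ⟨hmem, y, hy, hle⟩ := exists_alt_strip_two hn ha h
    rw [show 2 * (p + 1) + 3 = (2 * p + 3) + 2 by ring, strip_add_two]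
    exact ih hmem (hle.trans_lt (hy.pos_lt (by omega)))

lemma dpt_le (hn : 2 ≤ n) {p : ℕ} {a : Braid n} (ha : a ∈ Mb n)
    (h : pos n a < pos n (Δb n ^ (p + 1))) : dpt (Mb n) (M₁b n) (Nb n) a ≤ p + 1 := by
  have : bh (Mb n) (M₁b n) (Nb n) a ≤ 2 * p + 3 := Nat.sInf_le ⟨by omega, strip_eq_one hn ha h⟩
  rw [dpt]
  omega

lemma pos_delta_pow_le (hn : 2 ≤ n) {a : Braid n} (ha : a ∈ Mb n) :
    pos n (Δb n ^ (dpt (Mb n) (M₁b n) (Nb n) a - 1)) ≤ pos n a := by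
  rcases hp : dpt (Mb n) (M₁b n) (Nb n) a - 1 with _ | p
  · rw [pow_zero]
    exact pos_one_le ha
  · by_contra! hlt
    have := dpt_le hn ha hlt
    omega

theorem mem_thetaSet_of_dpt_add (hn : 2 ≤ n) {a b c : Braid n} {k : ℕ}
    (ha : a ∈ Mb n) (ha1 : a ∉ M₁b n) (hb : b ∈ Mb n) (hb1 : b ∉ M₁b n)
    (hc : c ∈ M₁b n) (hab : a * b = c * Δb n ^ k)
    (hd : dpt (Mb n) (M₁b n) (Nb n) a + dpt (Mb n) (M₁b n) (Nb n) b = k + 2) :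
    a ∈ thetaSet (M₁b n) (Δb n * (Δ₁b n)⁻¹) ∧
    b ∈ thetaSet (M₁b n) (Δb n * (Δ₁b n)⁻¹) := by
  have hA := pos_delta_pow_le hn ha
  have hB := pos_delta_pow_le hn hb
  set P := dpt (Mb n) (M₁b n) (Nb n) a
  set Q := dpt (Mb n) (M₁b n) (Nb n) b
  have hmono := pos_delta_pow_strictMono (n := n) (by omega)
  have hk : pos n (a * b) = pos n (Δb n ^ k) := by
    rw [hab, ← delta_pow_central, pos_mul_M₁b _ hc]
  have hstep : pos n (Δb n ^ (Q - 1) * a) ≤ pos n (a * b) := by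
    rw [delta_pow_central]
    exact pos_mul_le.2 hB
  have hstep' : pos n (Δb n ^ (Q - 1 + (P - 1))) ≤ pos n (Δb n ^ (Q - 1) * a) := by
    rw [pow_add]
    exact pos_mul_le.2 hA
  have hle : Q - 1 + (P - 1) ≤ k := hmono.le_iff_le.1 (hstep'.trans (hstep.trans hk.le))
  have hsum : k = Q - 1 + (P - 1) := by omega
  rw [hsum] at hk
  have eA : pos n a = pos n (Δb n ^ (P - 1)) := by
    refine le_antisymm ?_ hA
    rw [← pos_mul_le (g := Δb n ^ (Q - 1)), ← pow_add, ← hk]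
    exact hstep
  have eB : pos n b = pos n (Δb n ^ (Q - 1)) := by
    refine le_antisymm ?_ hB
    rw [← pos_mul_le (g := a), ← delta_pow_central, hk]
    exact hstep'
  obtain ⟨m, hm, e⟩ := exists_eq_theta_pow_mul ha eA
  obtain ⟨m', hm', e'⟩ := exists_eq_theta_pow_mul hb eB
  refine ⟨⟨P - 1, Nat.one_le_iff_ne_zero.2 fun h0 => ha1 ?_, m, hm, e⟩,
    ⟨Q - 1, Nat.one_le_iff_ne_zero.2 fun h0 => hb1 ?_, m', hm', e'⟩⟩
  · rw [e, h0, pow_zero, one_mul]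
    exact hm
  · rw [e', h0, pow_zero, one_mul]
    exact hm'

end Position

end BraidCurve

open GarsideOrder BraidOrder in
/-- If `a, b ∈ M \ M₁`, `c ∈ M₁`, `k ≥ 0`, `ab = c Δ^k` and `dpt a + dpt b = k + 2`,
then `a ∈ Θ` and `b ∈ Θ`. -/
theorem statement16 (n : ℕ) (hn : 2 ≤ n) (a b c : Braid n) (k : ℕ)
    (ha : a ∈ Mb n) (ha1 : a ∉ M₁b n) (hb : b ∈ Mb n) (hb1 : b ∉ M₁b n)
    (hc : c ∈ M₁b n) (hab : a * b = c * Δb n ^ k)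
    (hd : dpt (Mb n) (M₁b n) (Nb n) a + dpt (Mb n) (M₁b n) (Nb n) b = k + 2) :
    a ∈ thetaSet (M₁b n) (Δb n * (Δ₁b n)⁻¹) ∧
    b ∈ thetaSet (M₁b n) (Δb n * (Δ₁b n)⁻¹) := by
  exact BraidCurve.mem_thetaSet_of_dpt_add hn ha ha1 hb hb1 hc hab hd
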